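/- arXiv:1108.5949 — 5 statements merged into one kernel-verified Lean document; each statement's English description precedes it below -/
import Mathlib

section
/- Let G be a finite simple graph each of whose components has order at least 3, and let G have order n, size m, total domination number γt, and maximum degree Δ(G). Set Δ = 3 if Δ(G) = 2 and Δ = Δ(G) if Δ(G) ≥ 3. Then m ≤ Δ(n − γt). -/
open SimpleGraph

/-- The total domination number of a finite simple graph `G`: the minimum size of a set `S`
of vertices such that every vertex of `G` has a neighbor in `S`. -/
noncomputable def totalDominationNumber {V : Type*} [Fintype V] (G : SimpleGraph V) : ℕ :=
  sInf {n | ∃ S : Finset V, S.card = n ∧ ∀ v : V, ∃ u ∈ S, G.Adj v u}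

/-- The almost total domination number of `G` with respect to `v`: the minimum size of a set
`S` with `v ∈ S`, `v` having no neighbor in `S`, and every vertex other than `v` having a
neighbor in `S`. -/
noncomputable def almostTotalDominationNumber {V : Type*} [Fintype V] (G : SimpleGraph V)
    (v : V) : ℕ :=
  sInf {n | ∃ S : Finset V, S.card = n ∧ v ∈ S ∧ (∀ u ∈ S, ¬ G.Adj v u) ∧
    ∀ w : V, w ≠ v → ∃ u ∈ S, G.Adj w u}

/-- The graph obtained from `G` by deleting the vertex `v` and all incident edges. -/
def deleteVert {V : Type*} (G : SimpleGraph V) (v : V) : SimpleGraph {w : V // w ≠ v} :=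
  G.induce {w : V | w ≠ v}

/-- The cycle `C_n` on vertex set `Fin n`. -/
def cycleG (n : ℕ) : SimpleGraph (Fin n) :=
  SimpleGraph.fromRel (fun p q => (q : ℕ) = ((p : ℕ) + 1) % n)

/-- The 2-corona `C_k ∘ P_2` of the cycle `C_k`.  Vertex `(0, i)` is the cycle vertex `x_i`,
`(1, i)` is `x_i'` and `(2, i)` is `x_i''`, with pendant path `x_i x_i' x_i''`. -/
def coronaRel (k : ℕ) (p q : Fin 3 × Fin k) : Prop :=
  (p.1 = 0 ∧ q.1 = 0 ∧ (q.2 : ℕ) = ((p.2 : ℕ) + 1) % k) ∨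
  (p.1 = 0 ∧ q.1 = 1 ∧ p.2 = q.2) ∨
  (p.1 = 1 ∧ q.1 = 2 ∧ p.2 = q.2)

def coronaGraph (k : ℕ) : SimpleGraph (Fin 3 × Fin k) :=
  SimpleGraph.fromRel (coronaRel k)

/-- The edges of `G_k` common to `G_k`, `H_k`, `F_k`, `L_k` (0-indexed: `(0,i) = a_{i+1}`,
`(1,i) = b_{i+1}`, `(2,i) = c_{i+1}`, `(3,i) = d_{i+1}`): the two paths
`a_1 b_1 a_2 b_2 … a_k b_k` and `c_1 d_1 c_2 d_2 … c_k d_k`, and the edges `a_i d_i`,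
`b_i c_i`. -/
def gkBase (k : ℕ) (p q : Fin 4 × Fin k) : Prop :=
  (p.1 = 0 ∧ q.1 = 1 ∧ p.2 = q.2) ∨
  (p.1 = 1 ∧ q.1 = 0 ∧ (p.2 : ℕ) + 1 = (q.2 : ℕ)) ∨
  (p.1 = 2 ∧ q.1 = 3 ∧ p.2 = q.2) ∨
  (p.1 = 3 ∧ q.1 = 2 ∧ (p.2 : ℕ) + 1 = (q.2 : ℕ)) ∨
  (p.1 = 0 ∧ q.1 = 3 ∧ p.2 = q.2) ∨
  (p.1 = 1 ∧ q.1 = 2 ∧ p.2 = q.2)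

/-- The cubic graph `G_k`: the base edges together with `a_1 c_1` and `b_k d_k`. -/
def gkRel (k : ℕ) (p q : Fin 4 × Fin k) : Prop :=
  gkBase k p q ∨
  (p.1 = 0 ∧ q.1 = 2 ∧ (p.2 : ℕ) = 0 ∧ (q.2 : ℕ) = 0) ∨
  (p.1 = 1 ∧ q.1 = 3 ∧ (p.2 : ℕ) = k - 1 ∧ (q.2 : ℕ) = k - 1)

def GkGraph (k : ℕ) : SimpleGraph (Fin 4 × Fin k) :=
  SimpleGraph.fromRel (gkRel k)

/-- The cubic graph `H_k`: the base edges together with `a_1 b_k` and `c_1 d_k`. -/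
def hkRel (k : ℕ) (p q : Fin 4 × Fin k) : Prop :=
  gkBase k p q ∨
  (p.1 = 0 ∧ q.1 = 1 ∧ (p.2 : ℕ) = 0 ∧ (q.2 : ℕ) = k - 1) ∨
  (p.1 = 2 ∧ q.1 = 3 ∧ (p.2 : ℕ) = 0 ∧ (q.2 : ℕ) = k - 1)

def HkGraph (k : ℕ) : SimpleGraph (Fin 4 × Fin k) :=
  SimpleGraph.fromRel (hkRel k)

/-- Vertices of `F_k`: the vertices of `G_k` together with `v_1, v_2, v_3`
(encoded `Sum.inr 0`, `Sum.inr 1`, `Sum.inr 2`). -/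
abbrev FkVert (k : ℕ) := (Fin 4 × Fin k) ⊕ Fin 3

/-- `F_k` is obtained from `G_k` by subdividing the edge `a_1 c_1` three times,
giving the path `a_1 v_1 v_2 v_3 c_1`. -/
def fkRel (k : ℕ) (p q : FkVert k) : Prop :=
  match p, q with
  | Sum.inl p, Sum.inl q =>
      gkBase k p q ∨
      (p.1 = 1 ∧ q.1 = 3 ∧ (p.2 : ℕ) = k - 1 ∧ (q.2 : ℕ) = k - 1)
  | Sum.inl p, Sum.inr j =>
      (p.1 = 0 ∧ (p.2 : ℕ) = 0 ∧ j = 0) ∨ (p.1 = 2 ∧ (p.2 : ℕ) = 0 ∧ j = 2)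
  | Sum.inr i, Sum.inr j => (j : ℕ) = (i : ℕ) + 1
  | Sum.inr _, Sum.inl _ => False

def FkGraph (k : ℕ) : SimpleGraph (FkVert k) :=
  SimpleGraph.fromRel (fkRel k)

/-- Vertices of `L_k`: the vertices of `G_k` together with `v_1, v_2, v_3`
(encoded `Sum.inr (0, j)`) and `u_1, u_2, u_3` (encoded `Sum.inr (1, j)`). -/
abbrev LkVert (k : ℕ) := (Fin 4 × Fin k) ⊕ (Fin 2 × Fin 3)

/-- `L_k` is obtained from `G_k` by subdividing the edge `a_1 c_1` three times (path
`a_1 v_1 v_2 v_3 c_1`) and the edge `b_k d_k` three times (path `b_k u_1 u_2 u_3 d_k`). -/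
def lkRel (k : ℕ) (p q : LkVert k) : Prop :=
  match p, q with
  | Sum.inl p, Sum.inl q => gkBase k p q
  | Sum.inl p, Sum.inr j =>
      (p.1 = 0 ∧ (p.2 : ℕ) = 0 ∧ j = ((0 : Fin 2), (0 : Fin 3))) ∨
      (p.1 = 2 ∧ (p.2 : ℕ) = 0 ∧ j = ((0 : Fin 2), (2 : Fin 3))) ∨
      (p.1 = 1 ∧ (p.2 : ℕ) = k - 1 ∧ j = ((1 : Fin 2), (0 : Fin 3))) ∨
      (p.1 = 3 ∧ (p.2 : ℕ) = k - 1 ∧ j = ((1 : Fin 2), (2 : Fin 3)))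
  | Sum.inr i, Sum.inr j => i.1 = j.1 ∧ (j.2 : ℕ) = (i.2 : ℕ) + 1
  | Sum.inr _, Sum.inl _ => False

def LkGraph (k : ℕ) : SimpleGraph (LkVert k) :=
  SimpleGraph.fromRel (lkRel k)

/-- The generalized Petersen graph `GP(8,3)` of order 16: `(0, i) = u_i`, `(1, i) = w_i`. -/
def gpRel (p q : Fin 2 × Fin 8) : Prop :=
  (p.1 = 0 ∧ q.1 = 0 ∧ (q.2 : ℕ) = ((p.2 : ℕ) + 1) % 8) ∨
  (p.1 = 0 ∧ q.1 = 1 ∧ p.2 = q.2) ∨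
  (p.1 = 1 ∧ q.1 = 1 ∧ (q.2 : ℕ) = ((p.2 : ℕ) + 3) % 8)

def GP16 : SimpleGraph (Fin 2 × Fin 8) :=
  SimpleGraph.fromRel gpRel

/-- If no edge avoiding `x` meets `D`, deleting the edges through `x` loses at least the vertices
of `D`. -/
lemma card_biUnion_filter_notMem_add_card_le {V : Type*} [DecidableEq V]
    (H : Finset (Finset V)) (x : V) (D : Finset V) (hD : D ⊆ H.biUnion id)
    (hx : ∀ e ∈ H, x ∉ e → Disjoint e D) :
    ((H.filter fun e => x ∉ e).biUnion id).card + D.card ≤ (H.biUnion id).card := by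
  rw [← Finset.card_union_of_disjoint]
  · apply Finset.card_le_card
    apply Finset.union_subset _ hD
    exact Finset.biUnion_subset_biUnion_of_subset_left _ (Finset.filter_subset _ _)
  · rw [Finset.disjoint_biUnion_left]
    intro e he
    rw [Finset.mem_filter] at he
    exact hx e he.1 he.2

lemma mem_pair_of_card_filter_mem_eq_two {V : Type*} [DecidableEq V] {H : Finset (Finset V)}
    {v : V} (h : (H.filter fun e => v ∈ e).card = 2) {a b e : Finset V} (ha : a ∈ H)
    (hb : b ∈ H) (he : e ∈ H) (hva : v ∈ a) (hvb : v ∈ b) (hve : v ∈ e) (hab : a ≠ b) :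
    e = a ∨ e = b := by
  have hsub : {a, b} ⊆ H.filter fun e => v ∈ e := by
    intro c hc
    simp only [Finset.mem_insert, Finset.mem_singleton] at hc
    rcases hc with rfl | rfl <;> simp_all
  have heq := Finset.eq_of_subset_of_card_le hsub (by rw [h, Finset.card_pair hab])
  have : e ∈ H.filter fun e => v ∈ e := by simp [he, hve]
  rw [← heq] at this
  simpa using this

/-- A linear hypergraph with edges of size at least `3` in which each vertex has degree `2` has a
transversal of size at most a quarter of its order plus its size. -/
lemma exists_transversal_of_linear_of_degree_eq_two {V : Type*} [DecidableEq V]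
    (H : Finset (Finset V)) (h3 : ∀ e ∈ H, 3 ≤ e.card)
    (h2 : ∀ v ∈ H.biUnion id, (H.filter fun e => v ∈ e).card = 2)
    (hlin : ∀ e ∈ H, ∀ f ∈ H, ∀ x y, x ∈ e → x ∈ f → y ∈ e → y ∈ f → x ≠ y → e = f) :
    ∃ T : Finset V, (∀ e ∈ H, ∃ x ∈ e, x ∈ T) ∧
      4 * T.card ≤ (H.biUnion id).card + H.card := by
  classical
  set X := H.biUnion id with hX
  have memX : ∀ {e v}, e ∈ H → v ∈ e → v ∈ X := fun {e v} he hv =>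
    Finset.mem_biUnion.2 ⟨e, he, hv⟩
  let indep : Finset V → Prop := fun M => ∀ e ∈ H, ∀ p ∈ M, ∀ q ∈ M, p ∈ e → q ∈ e → p = q
  obtain ⟨M, hM, hmax⟩ := Finset.exists_max_image (X.powerset.filter indep) Finset.card
    ⟨∅, by simp [indep]⟩
  simp only [Finset.mem_filter, Finset.mem_powerset] at hM hmax
  obtain ⟨hMX, hMi⟩ := hM
  set U := H.filter fun e => ∀ p ∈ M, p ∉ e with hU
  have memU : ∀ {e}, e ∈ U ↔ e ∈ H ∧ ∀ p ∈ M, p ∉ e := by simp [hU]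
  have hUH : U ⊆ H := fun e he => (memU.1 he).1
  set W := X.filter fun v => v ∉ M ∧ ∀ e ∈ U, v ∉ e with hW
  have hUdisj : ∀ e ∈ U, ∀ f ∈ U, e ≠ f → Disjoint e f := by
    intro e he f hf hef
    rw [Finset.disjoint_left]
    intro v hve hvf
    have he' := memU.1 he
    have hf' := memU.1 hf
    have hvM : v ∉ M := fun h => he'.2 v h hve
    have := hmax (insert v M) ⟨Finset.insert_subset (memX he'.1 hve) hMX, by
      intro g hg p hp q hq hpg hqg
      have key : ∀ q ∈ M, v ∈ g → q ∈ g → v = q := by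
        intro q hq hvg hqg
        rcases mem_pair_of_card_filter_mem_eq_two (h2 v (memX he'.1 hve)) he'.1 hf'.1 hg hve hvf
          hvg hef with rfl | rfl
        · exact absurd hqg (he'.2 q hq)
        · exact absurd hqg (hf'.2 q hq)
      rw [Finset.mem_insert] at hp hq
      rcases hp with hp | hp <;> rcases hq with hq | hq
      · rw [hp, hq]
      · rw [hp] at hpg ⊢
        exact key q hq hpg hqg
      · rw [hq] at hqg ⊢
        exact (key p hp hqg hpg).symm
      · exact hMi g hg p hp q hq hpg hqg⟩
    rw [Finset.card_insert_of_notMem hvM] at this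
    omega
  -- an alternating path through `m` between two uncovered edges would enlarge `M`
  have augment : ∀ m ∈ M, ∀ a ∈ H, ∀ b ∈ H, a ≠ b → m ∈ a → m ∈ b → ∀ u ∈ U, ∀ u' ∈ U, u ≠ u' →
      ∀ v v', v ∈ a → v ∈ u → v' ∈ b → v' ∈ u' → False := by
    intro m hm a ha b hb hab hma hmb u hu u' hu' huu v v' hva hvu hvb hvu'
    have hu1 := memU.1 hu
    have hu1' := memU.1 hu'
    have hau : ∀ w ∈ U, a ≠ w := fun w hw h => (memU.1 hw).2 m hm (h ▸ hma)
    have hbu : ∀ w ∈ U, b ≠ w := fun w hw h => (memU.1 hw).2 m hm (h ▸ hmb)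
    have hvM : v ∉ M := fun h => hu1.2 v h hvu
    have hvM' : v' ∉ M := fun h => hu1'.2 v' h hvu'
    have hvm : m ≠ v := fun h => hvM (h ▸ hm)
    have hvv : v ≠ v' := by
      rintro rfl
      exact hab (hlin a ha b hb m v hma hmb hva hvb hvm)
    have ed := fun g (hg : g ∈ H) (h : v ∈ g) => mem_pair_of_card_filter_mem_eq_two
      (h2 v (memX ha hva)) ha hu1.1 hg hva hvu h (hau u hu)
    have ed' := fun g (hg : g ∈ H) (h : v' ∈ g) => mem_pair_of_card_filter_mem_eq_two
      (h2 v' (memX hb hvb)) hb hu1'.1 hg hvb hvu' h (hbu u' hu')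
    have k1 : ∀ g ∈ H, v ∈ g → v' ∈ g → False := by
      intro g hg h h'
      rcases ed g hg h with rfl | rfl <;> rcases ed' g hg h' with h1 | h1
      · exact hab h1
      · exact hau u' hu' h1
      · exact hbu _ hu h1.symm
      · exact huu h1
    have k2 : ∀ g ∈ H, ∀ q ∈ M.erase m, v ∈ g → q ∈ g → False := by
      intro g hg q hq h h'
      rw [Finset.mem_erase] at hq
      rcases ed g hg h with rfl | rfl
      · exact hq.1 (hMi g hg q hq.2 m hm h' hma)
      · exact hu1.2 q hq.2 h'
    have k3 : ∀ g ∈ H, ∀ q ∈ M.erase m, v' ∈ g → q ∈ g → False := by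
      intro g hg q hq h h'
      rw [Finset.mem_erase] at hq
      rcases ed' g hg h with rfl | rfl
      · exact hq.1 (hMi g hg q hq.2 m hm h' hmb)
      · exact hu1'.2 q hq.2 h'
    have := hmax (insert v (insert v' (M.erase m))) ⟨by
      refine Finset.insert_subset (memX ha hva) (Finset.insert_subset (memX hb hvb) ?_)
      exact (Finset.erase_subset _ _).trans hMX, by
      intro g hg p hp q hq hpg hqg
      simp only [Finset.mem_insert] at hp hq
      rcases hp with hp | hp | hp <;> rcases hq with hq | hq | hq
      · rw [hp, hq]
      · exact (k1 g hg (hp ▸ hpg) (hq ▸ hqg)).elim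
      · exact (k2 g hg q hq (hp ▸ hpg) hqg).elim
      · exact (k1 g hg (hq ▸ hqg) (hp ▸ hpg)).elim
      · rw [hp, hq]
      · exact (k3 g hg q hq (hp ▸ hpg) hqg).elim
      · exact (k2 g hg p hp (hq ▸ hqg) hpg).elim
      · exact (k3 g hg p hp (hq ▸ hqg) hpg).elim
      · exact hMi g hg p (Finset.mem_of_mem_erase hp) q (Finset.mem_of_mem_erase hq) hpg hqg⟩
    rw [Finset.card_insert_of_notMem (by simp [hvv, hvM]),
      Finset.card_insert_of_notMem (by simp [hvM']), Finset.card_erase_of_mem hm] at this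
    have := Finset.card_pos.2 ⟨m, hm⟩
    omega
  have hWcount : M.card ≤ W.card := by
    have notW : ∀ m ∈ M, ∀ a ∈ H, m ∈ a → ∀ v ∈ a.erase m, v ∉ a ∩ W → ∃ u ∈ U, v ∈ u := by
      intro m hm a ha hma v hv hvW
      rw [Finset.mem_erase] at hv
      by_contra! hcon
      refine hvW (Finset.mem_inter.2 ⟨hv.2, Finset.mem_filter.2 ⟨memX ha hv.2, ?_, hcon⟩⟩)
      exact fun h => hv.1 (hMi a ha v h m hm hv.2 hma)
    have half : ∀ m ∈ M, ∀ a ∈ H, ∀ b ∈ H, a ≠ b → m ∈ a → m ∈ b → (a ∩ W).card = 0 →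
        2 ≤ (b ∩ W).card := by
      intro m hm a ha b hb hab hma hmb h0
      by_contra! h1
      have ha2 : 1 < (a.erase m).card := by
        rw [Finset.card_erase_of_mem hma]; have := h3 a ha; omega
      have hb2 : (b ∩ W).card < (b.erase m).card := by
        rw [Finset.card_erase_of_mem hmb]; have := h3 b hb; omega
      obtain ⟨v', hv', hvW'⟩ := Finset.exists_mem_notMem_of_card_lt_card hb2
      obtain ⟨u', hu', hvu'⟩ := notW m hm b hb hmb v' hv' hvW'
      obtain ⟨v1, hv1, v2, hv2, hne⟩ := Finset.one_lt_card.1 ha2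
      rw [Finset.card_eq_zero] at h0
      obtain ⟨u1, hu1, hvu1⟩ := notW m hm a ha hma v1 hv1 (by simp [h0])
      obtain ⟨u2, hu2, hvu2⟩ := notW m hm a ha hma v2 hv2 (by simp [h0])
      have hu12 : u1 ≠ u2 := by
        rintro rfl
        have := hlin a ha u1 (memU.1 hu1).1 v1 v2 (Finset.mem_of_mem_erase hv1) hvu1
          (Finset.mem_of_mem_erase hv2) hvu2 hne
        exact (memU.1 hu1).2 m hm (this ▸ hma)
      by_cases h : u1 = u'
      · exact augment m hm a ha b hb hab hma hmb u2 hu2 u' hu' (fun h' => hu12 (h.trans h'.symm))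
          v2 v' (Finset.mem_of_mem_erase hv2) hvu2 (Finset.mem_of_mem_erase hv') hvu'
      · exact augment m hm a ha b hb hab hma hmb u1 hu1 u' hu' h
          v1 v' (Finset.mem_of_mem_erase hv1) hvu1 (Finset.mem_of_mem_erase hv') hvu'
    have each : ∀ m ∈ M, 2 ≤ ∑ e ∈ H with m ∈ e, (e ∩ W).card := by
      intro m hm
      obtain ⟨a, b, hab, hfil⟩ := Finset.card_eq_two.1 (h2 m (hMX hm))
      have ha : a ∈ H.filter fun e => m ∈ e := by simp [hfil]
      have hb : b ∈ H.filter fun e => m ∈ e := by simp [hfil]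
      rw [hfil, Finset.sum_pair hab]
      rw [Finset.mem_filter] at ha hb
      have h1 := half m hm a ha.1 b hb.1 hab ha.2 hb.2
      have h2 := half m hm b hb.1 a ha.1 hab.symm hb.2 ha.2
      omega
    have s1 : M.card * 2 ≤ ∑ m ∈ M, ∑ e ∈ H with m ∈ e, (e ∩ W).card := by
      rw [← smul_eq_mul]
      exact Finset.card_nsmul_le_sum _ _ _ each
    have s2 : ∑ m ∈ M, ∑ e ∈ H with m ∈ e, (e ∩ W).card ≤ ∑ e ∈ H, (W ∩ e).card := by
      simp_rw [Finset.sum_filter]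
      rw [Finset.sum_comm]
      apply Finset.sum_le_sum
      intro e he
      rw [← Finset.sum_filter, Finset.sum_const, smul_eq_mul, Finset.inter_comm W e]
      have : (M.filter fun m => m ∈ e).card ≤ 1 := by
        rw [Finset.card_le_one]
        simp only [Finset.mem_filter]
        exact fun p hp q hq => hMi e he p hp.1 q hq.1 hp.2 hq.2
      nlinarith
    have s3 : ∑ e ∈ H, (W ∩ e).card = W.card * 2 :=
      Finset.sum_card_inter fun v hv => h2 v (Finset.mem_filter.1 hv).1
    omega
  have hHcount : 2 * M.card + U.card ≤ H.card := by
    have s1 : ∑ e ∈ H, (M ∩ e).card = M.card * 2 :=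
      Finset.sum_card_inter fun v hv => h2 v (hMX hv)
    have s2 : ∑ e ∈ H, (M ∩ e).card ≤ ∑ e ∈ H, if e ∈ U then 0 else 1 := by
      apply Finset.sum_le_sum
      intro e he
      split_ifs with heU
      · rw [Nat.le_zero, Finset.card_eq_zero, ← Finset.disjoint_iff_inter_eq_empty,
          Finset.disjoint_left]
        exact fun p hp => (memU.1 heU).2 p hp
      · rw [Finset.card_le_one]
        simp only [Finset.mem_inter]
        exact fun p hp q hq => hMi e he p hp.1 q hq.1 hp.2 hq.2
    have s3 : (∑ e ∈ H, if e ∈ U then 0 else 1) + U.card = H.card := by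
      have : (∑ e ∈ H, if e ∈ U then 0 else 1) = (H \ U).card := by
        rw [← Finset.filter_notMem_eq_sdiff, Finset.card_filter]
        exact Finset.sum_congr rfl fun e _ => by split_ifs <;> simp_all
      rw [this, Finset.card_sdiff_add_card_eq_card hUH]
    omega
  have hXcount : 2 * M.card + 3 * U.card ≤ X.card := by
    have hUX : 3 * U.card ≤ (U.biUnion id).card := by
      have hc : (U.biUnion id).card = ∑ e ∈ U, e.card := Finset.card_biUnion hUdisj
      rw [hc, mul_comm, ← smul_eq_mul]
      exact Finset.card_nsmul_le_sum _ _ _ fun e he => h3 e (memU.1 he).1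
    have hd1 : Disjoint M W := by
      rw [Finset.disjoint_left]
      exact fun v hv hvW => (Finset.mem_filter.1 hvW).2.1 hv
    have hd2 : Disjoint (M ∪ W) (U.biUnion id) := by
      rw [Finset.disjoint_left]
      intro v hv hvU
      obtain ⟨u, hu, hvu⟩ := Finset.mem_biUnion.1 hvU
      rcases Finset.mem_union.1 hv with h | h
      · exact (memU.1 hu).2 v h hvu
      · exact (Finset.mem_filter.1 h).2.2 u hu hvu
    have hsub : M ∪ W ∪ U.biUnion id ⊆ X :=
      Finset.union_subset (Finset.union_subset hMX (Finset.filter_subset _ _))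
        (Finset.biUnion_subset_biUnion_of_subset_left _ hUH)
    have := Finset.card_le_card hsub
    rw [Finset.card_union_of_disjoint hd2, Finset.card_union_of_disjoint hd1] at this
    omega
  have hne : ∀ e ∈ U, ∃ x, x ∈ e := fun e he =>
    Finset.card_pos.1 (by have := h3 e (memU.1 he).1; omega)
  choose r hr using hne
  refine ⟨M ∪ U.attach.image fun e => r e.1 e.2, fun e he => ?_, ?_⟩
  · by_cases heU : e ∈ U
    · exact ⟨r e heU, hr e heU, Finset.mem_union_right _
        (Finset.mem_image.2 ⟨⟨e, heU⟩, Finset.mem_attach _ _, rfl⟩)⟩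
    · have : ∃ p ∈ M, p ∈ e := by
        by_contra! hcon
        exact heU (memU.2 ⟨he, hcon⟩)
      obtain ⟨p, hp, hpe⟩ := this
      exact ⟨p, hpe, Finset.mem_union_left _ hp⟩
  · have c1 := Finset.card_union_le M (U.attach.image fun e => r e.1 e.2)
    have c2 : (U.attach.image fun e => r e.1 e.2).card ≤ U.card :=
      Finset.card_image_le.trans Finset.card_attach.le
    omega

/-- A hypergraph with edges of size at least `3` has a transversal of size at most a quarter of its
order plus its size (Chvátal–McDiarmid). -/
lemma exists_transversal_four_mul_card_le {V : Type*} [DecidableEq V]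
    (H : Finset (Finset V)) (h3 : ∀ e ∈ H, 3 ≤ e.card) :
    ∃ T : Finset V, (∀ e ∈ H, ∃ x ∈ e, x ∈ T) ∧
      4 * T.card ≤ (H.biUnion id).card + H.card := by
  induction hn : H.card using Nat.strong_induction_on generalizing H with
  | _ n ih =>
  subst hn
  have memX : ∀ {e v}, e ∈ H → v ∈ e → v ∈ H.biUnion id := fun {e v} he hv =>
    Finset.mem_biUnion.2 ⟨e, he, hv⟩
  have pick : ∀ x, ∀ D ⊆ H.biUnion id, (∀ e ∈ H, x ∉ e → Disjoint e D) →
      0 < (H.filter fun e => x ∈ e).card → 4 ≤ D.card + (H.filter fun e => x ∈ e).card →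
      ∃ T : Finset V, (∀ e ∈ H, ∃ x ∈ e, x ∈ T) ∧
        4 * T.card ≤ (H.biUnion id).card + H.card := by
    intro x D hD hxD hpos h4
    have hc := Finset.card_filter_add_card_filter_not (s := H) (fun e => x ∈ e)
    obtain ⟨T, hT, hTc⟩ := ih (H.filter fun e => x ∉ e).card (by omega) (H.filter fun e => x ∉ e)
      (fun e he => h3 e (Finset.mem_filter.1 he).1) rfl
    refine ⟨insert x T, fun e he => ?_, ?_⟩
    · by_cases hxe : x ∈ e
      · exact ⟨x, hxe, Finset.mem_insert_self _ _⟩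
      · obtain ⟨y, hy, hyT⟩ := hT e (by simp [he, hxe])
        exact ⟨y, hy, Finset.mem_insert_of_mem hyT⟩
    · have h1 := card_biUnion_filter_notMem_add_card_le H x D hD hxD
      have h2 := Finset.card_insert_le x T
      omega
  by_cases hdeg : ∃ x, 3 ≤ (H.filter fun e => x ∈ e).card
  · obtain ⟨x, hx⟩ := hdeg
    obtain ⟨e, he⟩ := Finset.card_pos.1 (by omega : 0 < (H.filter fun e => x ∈ e).card)
    rw [Finset.mem_filter] at he
    exact pick x {x} (by simpa using memX he.1 he.2) (by simp) (by omega) (by simp; omega)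
  push Not at hdeg
  by_cases hdom : ∃ x y, x ≠ y ∧ 2 ≤ (H.filter fun e => x ∈ e).card ∧ y ∈ H.biUnion id ∧
      ∀ e ∈ H, y ∈ e → x ∈ e
  · obtain ⟨x, y, hxy, hx, hy, hyx⟩ := hdom
    obtain ⟨e, he, hye⟩ := Finset.mem_biUnion.1 hy
    refine pick x {x, y} ?_ ?_ (by omega) (by rw [Finset.card_pair hxy]; omega)
    · intro z hz
      simp only [Finset.mem_insert, Finset.mem_singleton] at hz
      rcases hz with rfl | rfl
      · exact memX he (hyx e he hye)
      · exact hy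
    · intro f hf hxf
      simp only [Finset.disjoint_insert_right, Finset.disjoint_singleton_right]
      exact ⟨hxf, fun h => hxf (hyx f hf h)⟩
  push Not at hdom
  by_cases hiso : ∃ e ∈ H, ∀ x ∈ e, ∀ f ∈ H, x ∈ f → f = e
  · obtain ⟨e, he, hiso⟩ := hiso
    obtain ⟨x, hx⟩ := Finset.card_pos.1 (by have := h3 e he; omega : 0 < e.card)
    have hpos : 0 < (H.filter fun e => x ∈ e).card := Finset.card_pos.2 ⟨e, by simp [he, hx]⟩
    refine pick x e (fun z hz => memX he hz) ?_ hpos (by have := h3 e he; omega)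
    intro f hf hxf
    rw [Finset.disjoint_left]
    exact fun z hzf hze => hxf (hiso z hze f hf hzf ▸ hx)
  push Not at hiso
  have two : ∀ {x e f}, e ∈ H → f ∈ H → x ∈ e → x ∈ f → e ≠ f →
      (H.filter fun e => x ∈ e).card = 2 := by
    intro x e f he hf hxe hxf hef
    have : 1 < (H.filter fun e => x ∈ e).card :=
      Finset.one_lt_card.2 ⟨e, by simp [he, hxe], f, by simp [hf, hxf], hef⟩
    have := hdeg x
    omega
  have h2 : ∀ v ∈ H.biUnion id, (H.filter fun e => v ∈ e).card = 2 := by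
    intro v hv
    obtain ⟨e, he, hve⟩ := Finset.mem_biUnion.1 hv
    obtain ⟨x, hx, f, hf, hxf, hfe⟩ := hiso e he
    have hx2 := two hf he hxf hx hfe
    by_cases hvx : v = x
    · rwa [hvx]
    obtain ⟨g, hg, hvg, hxg⟩ := hdom x v (Ne.symm hvx) hx2.ge hv
    exact two hg he hvg hve (fun h => hxg (h ▸ hx))
  apply exists_transversal_of_linear_of_degree_eq_two H h3 h2
  intro e he f hf x y hxe hxf hye hyf hxy
  by_contra hef
  obtain ⟨g, hg, hyg, hxg⟩ := hdom x y hxy (two he hf hxe hxf hef).ge (memX he hye)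
  rcases mem_pair_of_card_filter_mem_eq_two (two he hf hye hyf hef) he hf hg hye hyf hyg hef with
    rfl | rfl
  · exact hxg hxe
  · exact hxg hxf

/-- The weight of a hyperedge: `2` for edges of size `2` and `1` otherwise. -/
def hyperedgeWeight {V : Type*} (e : Finset V) : ℕ := if e.card = 2 then 2 else 1

lemma one_le_hyperedgeWeight {V : Type*} (e : Finset V) : 1 ≤ hyperedgeWeight e := by
  unfold hyperedgeWeight; split_ifs <;> omega

lemma hyperedgeWeight_le_two {V : Type*} (e : Finset V) : hyperedgeWeight e ≤ 2 := by
  unfold hyperedgeWeight; split_ifs <;> omega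

/-- A hypergraph with edges of size at least `2` and order `n`, with `e₂` edges of size `2` and `e₃`
larger ones, has a transversal of size at most `(2 n + 2 e₂ + e₃) / 6`. -/
lemma exists_transversal_six_mul_card_le {V : Type*} [DecidableEq V]
    (H : Finset (Finset V)) (h2 : ∀ e ∈ H, 2 ≤ e.card) :
    ∃ T : Finset V, (∀ e ∈ H, ∃ x ∈ e, x ∈ T) ∧
      6 * T.card ≤ 2 * (H.biUnion id).card + ∑ e ∈ H, hyperedgeWeight e := by
  induction hn : H.card using Nat.strong_induction_on generalizing H with
  | _ n ih =>
  subst hn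
  have memX : ∀ {e v}, e ∈ H → v ∈ e → v ∈ H.biUnion id := fun {e v} he hv =>
    Finset.mem_biUnion.2 ⟨e, he, hv⟩
  have pick : ∀ x, ∀ D ⊆ H.biUnion id, (∀ e ∈ H, x ∉ e → Disjoint e D) →
      (∃ e ∈ H, x ∈ e) → 6 ≤ 2 * D.card + ∑ e ∈ H with x ∈ e, hyperedgeWeight e →
      ∃ T : Finset V, (∀ e ∈ H, ∃ x ∈ e, x ∈ T) ∧
        6 * T.card ≤ 2 * (H.biUnion id).card + ∑ e ∈ H, hyperedgeWeight e := by
    intro x D hD hxD ⟨e, he, hxe⟩ h6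
    have hlt : (H.filter fun e => x ∉ e).card < H.card :=
      Finset.card_lt_card (Finset.filter_ssubset.2 ⟨e, he, by simpa using hxe⟩)
    have hs := Finset.sum_filter_add_sum_filter_not H (fun e => x ∈ e) hyperedgeWeight
    obtain ⟨T, hT, hTc⟩ := ih (H.filter fun e => x ∉ e).card hlt (H.filter fun e => x ∉ e)
      (fun e he => h2 e (Finset.mem_filter.1 he).1) rfl
    refine ⟨insert x T, fun e he => ?_, ?_⟩
    · by_cases hxe : x ∈ e
      · exact ⟨x, hxe, Finset.mem_insert_self _ _⟩
      · obtain ⟨y, hy, hyT⟩ := hT e (by simp [he, hxe])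
        exact ⟨y, hy, Finset.mem_insert_of_mem hyT⟩
    · have h1 := card_biUnion_filter_notMem_add_card_le H x D hD hxD
      have h2 := Finset.card_insert_le x T
      omega
  by_cases hdeg : ∃ x, 4 ≤ ∑ e ∈ H with x ∈ e, hyperedgeWeight e
  · obtain ⟨x, hx⟩ := hdeg
    obtain ⟨e, he⟩ : (H.filter fun e => x ∈ e).Nonempty := by
      by_contra h
      rw [Finset.not_nonempty_iff_eq_empty] at h
      rw [h, Finset.sum_empty] at hx
      omega
    rw [Finset.mem_filter] at he
    exact pick x {x} (by simpa using memX he.1 he.2) (by simp) ⟨e, he⟩ (by simp; omega)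
  push Not at hdeg
  have sum_le : ∀ {x} (s : Finset (Finset V)), (∀ e ∈ s, e ∈ H ∧ x ∈ e) →
      ∑ e ∈ s, hyperedgeWeight e ≤ ∑ e ∈ H with x ∈ e, hyperedgeWeight e := by
    intro x s hs
    exact Finset.sum_le_sum_of_subset fun e he => Finset.mem_filter.2 (hs e he)
  by_cases htwo : ∃ f ∈ H, f.card = 2
  · obtain ⟨f, hf, hfc⟩ := htwo
    have hwf : hyperedgeWeight f = 2 := by simp [hyperedgeWeight, hfc]
    have unique : ∀ {x e g}, x ∈ f → e ∈ H → g ∈ H → x ∈ e → x ∈ g → e ≠ f → g ≠ f → e = g := by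
      intro x e g hxf he hg hxe hxg hef hgf
      by_contra heg
      have h1 := sum_le (x := x) {f, e, g} (by
        intro a ha
        simp only [Finset.mem_insert, Finset.mem_singleton] at ha
        rcases ha with rfl | rfl | rfl <;> exact ⟨by assumption, by assumption⟩)
      rw [Finset.sum_insert (by simp [hef.symm, hgf.symm]), Finset.sum_pair heg] at h1
      have := hdeg x
      have := one_le_hyperedgeWeight e
      have := one_le_hyperedgeWeight g
      omega
    have weight : ∀ {x e}, x ∈ f → e ∈ H → x ∈ e → e ≠ f → hyperedgeWeight e = 1 := by
      intro x e hxf he hxe hef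
      have h1 := sum_le (x := x) {f, e} (by
        intro a ha
        simp only [Finset.mem_insert, Finset.mem_singleton] at ha
        rcases ha with rfl | rfl <;> exact ⟨by assumption, by assumption⟩)
      rw [Finset.sum_pair hef.symm] at h1
      have := hdeg x
      have := one_le_hyperedgeWeight e
      omega
    -- a vertex of `f` all of whose edges pass through the other vertex of `f`
    have pendant : ∀ x y, x ≠ y → x ∈ f → y ∈ f → (∀ e ∈ H, y ∈ e → x ∈ e) →
        ∃ T : Finset V, (∀ e ∈ H, ∃ x ∈ e, x ∈ T) ∧
          6 * T.card ≤ 2 * (H.biUnion id).card + ∑ e ∈ H, hyperedgeWeight e := by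
      intro x y hxy hx hy hyx
      refine pick x {x, y} ?_ ?_ ⟨f, hf, hx⟩ ?_
      · simp only [Finset.insert_subset_iff, Finset.singleton_subset_iff]
        exact ⟨memX hf hx, memX hf hy⟩
      · intro e he hxe
        simp only [Finset.disjoint_insert_right, Finset.disjoint_singleton_right]
        exact ⟨hxe, fun h => hxe (hyx e he h)⟩
      · have h1 := sum_le (x := x) {f} (by simp [hf, hx])
        rw [Finset.sum_singleton] at h1
        rw [Finset.card_pair hxy]
        omega
    obtain ⟨y, z, hyz, rfl⟩ := Finset.card_eq_two.1 hfc
    by_cases hp1 : ∀ e ∈ H, z ∈ e → y ∈ e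
    · exact pendant y z hyz (by simp) (by simp) hp1
    by_cases hp2 : ∀ e ∈ H, y ∈ e → z ∈ e
    · exact pendant z y hyz.symm (by simp) (by simp) hp2
    push Not at hp1 hp2
    obtain ⟨b, hb, hzb, hyb⟩ := hp1
    obtain ⟨a, ha, hya, hza⟩ := hp2
    have haf : a ≠ {y, z} := by rintro rfl; simp at hza
    have hbf : b ≠ {y, z} := by rintro rfl; simp at hyb
    have hab : a ≠ b := by rintro rfl; exact hyb hya
    have hwa := weight (x := y) (by simp) ha hya haf
    have hwb := weight (x := z) (by simp) hb hzb hbf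
    set K := H \ {{y, z}, a, b} with hK
    have hsub : ({{y, z}, a, b} : Finset (Finset V)) ⊆ H := by
      simp only [Finset.insert_subset_iff, Finset.singleton_subset_iff]
      exact ⟨hf, ha, hb⟩
    have hcard3 : ({{y, z}, a, b} : Finset (Finset V)).card = 3 := by
      rw [Finset.card_eq_three]; exact ⟨_, _, _, haf.symm, hbf.symm, hab, rfl⟩
    have hKc := Finset.card_sdiff_add_card_eq_card hsub
    have hKs := Finset.sum_sdiff (f := hyperedgeWeight) hsub
    rw [← hK, Finset.sum_insert (by simp [haf.symm, hbf.symm]), Finset.sum_pair hab] at hKs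
    rw [← hK, hcard3] at hKc
    have hKmem : ∀ {e}, e ∈ K → e ∈ H ∧ y ∉ e ∧ z ∉ e := by
      intro e he
      simp only [hK, Finset.mem_sdiff, Finset.mem_insert, Finset.mem_singleton, not_or] at he
      exact ⟨he.1, fun h => he.2.2.1 (unique (x := y) (by simp) he.1 ha h hya he.2.1 haf),
        fun h => he.2.2.2 (unique (x := z) (by simp) he.1 hb h hzb he.2.1 hbf)⟩
    set g := (a ∪ b) \ {y, z} with hg
    have hac : 3 ≤ a.card := by
      have := h2 a ha
      have : a.card ≠ 2 := fun h => by simp [hyperedgeWeight, h] at hwa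
      omega
    have hgc : 2 ≤ g.card := by
      have : a.erase y ⊆ g := by
        intro v hv
        simp only [Finset.mem_erase] at hv
        simp only [hg, Finset.mem_sdiff, Finset.mem_union, Finset.mem_insert,
          Finset.mem_singleton, not_or]
        exact ⟨Or.inl hv.2, hv.1, fun h => hza (h ▸ hv.2)⟩
      have := Finset.card_le_card this
      rw [Finset.card_erase_of_mem hya] at this
      omega
    have hic := Finset.card_insert_le g K
    obtain ⟨T, hT, hTc⟩ := ih (insert g K).card (by omega) (insert g K) (by
      intro e he
      rcases Finset.mem_insert.1 he with rfl | he
      · exact hgc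
      · exact h2 e (hKmem he).1) rfl
    have hs : ∑ e ∈ insert g K, hyperedgeWeight e ≤ 2 + ∑ e ∈ K, hyperedgeWeight e := by
      by_cases h : g ∈ K
      · rw [Finset.insert_eq_of_mem h]; omega
      · rw [Finset.sum_insert h]
        have := hyperedgeWeight_le_two g
        omega
    have hv : ((insert g K).biUnion id).card + 2 ≤ (H.biUnion id).card := by
      rw [← Finset.card_pair hyz, ← Finset.card_union_of_disjoint]
      · apply Finset.card_le_card
        apply Finset.union_subset
        · rw [Finset.biUnion_subset]
          intro e he
          rcases Finset.mem_insert.1 he with rfl | he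
          · intro v hv
            simp only [id, hg, Finset.mem_sdiff, Finset.mem_union] at hv
            rcases hv.1 with h | h
            · exact memX ha h
            · exact memX hb h
          · exact fun v hv => memX (hKmem he).1 hv
        · exact fun v hv => memX hf hv
      · rw [Finset.disjoint_biUnion_left]
        intro e he
        rcases Finset.mem_insert.1 he with rfl | he
        · exact Finset.sdiff_disjoint
        · simp only [id, Finset.disjoint_insert_right, Finset.disjoint_singleton_right]
          exact (hKmem he).2
    have finish : ∀ w, (∃ x ∈ ({y, z} : Finset V), x ∈ insert w T) → (∃ x ∈ a, x ∈ insert w T) →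
        (∃ x ∈ b, x ∈ insert w T) → ∃ T : Finset V, (∀ e ∈ H, ∃ x ∈ e, x ∈ T) ∧
          6 * T.card ≤ 2 * (H.biUnion id).card + ∑ e ∈ H, hyperedgeWeight e := by
      intro w hwf hwa' hwb'
      refine ⟨insert w T, fun e he => ?_, ?_⟩
      · by_cases heK : e ∈ K
        · obtain ⟨x, hx, hxT⟩ := hT e (Finset.mem_insert_of_mem heK)
          exact ⟨x, hx, Finset.mem_insert_of_mem hxT⟩
        · simp only [hK, Finset.mem_sdiff, he, true_and, not_not, Finset.mem_insert,
            Finset.mem_singleton] at heK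
          rcases heK with rfl | rfl | rfl
          · exact hwf
          · exact hwa'
          · exact hwb'
      · have := Finset.card_insert_le w T
        omega
    obtain ⟨x, hxg, hxT⟩ := hT g (Finset.mem_insert_self _ _)
    simp only [hg, Finset.mem_sdiff, Finset.mem_union] at hxg
    rcases hxg.1 with h | h
    · exact finish z ⟨z, by simp, by simp⟩ ⟨x, h, by simp [hxT]⟩ ⟨z, hzb, by simp⟩
    · exact finish y ⟨y, by simp, by simp⟩ ⟨y, hya, by simp⟩ ⟨x, h, by simp [hxT]⟩
  push Not at htwo
  have h3 : ∀ e ∈ H, 3 ≤ e.card := fun e he => by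
    have := h2 e he
    have := htwo e he
    omega
  have hw : ∀ s ⊆ H, ∑ e ∈ s, hyperedgeWeight e = s.card := by
    intro s hs
    rw [Finset.card_eq_sum_ones]
    exact Finset.sum_congr rfl fun e he => by simp [hyperedgeWeight, htwo e (hs he)]
  obtain ⟨T, hT, hTc⟩ := exists_transversal_four_mul_card_le H h3
  refine ⟨T, hT, ?_⟩
  have c1 : ∑ e ∈ H, ((H.biUnion id) ∩ e).card ≤ (H.biUnion id).card * 3 :=
    Finset.sum_card_inter_le fun x _ => by
      have := hdeg x
      rw [hw _ (Finset.filter_subset _ _)] at this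
      omega
  have c2 : H.card * 3 ≤ ∑ e ∈ H, ((H.biUnion id) ∩ e).card := by
    rw [← smul_eq_mul]
    refine Finset.card_nsmul_le_sum _ _ _ fun e he => ?_
    rw [Finset.inter_eq_right.2 fun v hv => memX he hv]
    exact h3 e he
  rw [hw H subset_rfl]
  omega

/-- In a graph without components of order at most `2`, the total domination number is at most
`∑ w (deg v)`, where `w 1 = 5 / 6`, `w 2 = 4 / 6` and `w d = 3 / 6` for `3 ≤ d`. -/
lemma exists_totalDominating_six_mul_card_le {V : Type*} [Fintype V] [DecidableEq V]
    (G : SimpleGraph V) [DecidableRel G.Adj] (hpos : ∀ v, 1 ≤ G.degree v)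
    (hleaf : ∀ u v, G.Adj u v → G.degree u = 1 → G.degree v ≠ 1) :
    ∃ T : Finset V, (∀ v, ∃ u ∈ T, G.Adj v u) ∧
      6 * T.card ≤ ∑ v, if G.degree v = 1 then 5 else if G.degree v = 2 then 4 else 3 := by
  set L : Finset V := Finset.univ.filter fun v => G.degree v = 1 with hL
  have memL : ∀ {v}, v ∈ L ↔ G.degree v = 1 := by simp [hL]
  let ℓ : V → Finset V := fun v => G.neighborFinset v ∩ L
  let N : V → Finset V := fun v => G.neighborFinset v \ L
  have mem_ℓ : ∀ {v w}, w ∈ ℓ v ↔ G.Adj v w ∧ G.degree w = 1 := by simp [ℓ, memL]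
  have memN : ∀ {v w}, w ∈ N v ↔ G.Adj v w ∧ G.degree w ≠ 1 := by simp [N, memL]
  have hdeg : ∀ v, G.degree v = (ℓ v).card + (N v).card := fun v => by
    rw [← G.card_neighborFinset_eq_degree, Finset.card_inter_add_card_sdiff]
  set S : Finset V := Finset.univ.filter fun v => (ℓ v).Nonempty with hS
  have memS : ∀ {v}, v ∈ S ↔ (ℓ v).Nonempty := by simp [hS]
  set S₀ := S.filter fun v => (N v).card = 0 with hS₀
  set S₁ := S.filter fun v => (N v).card = 1 with hS₁
  set A := S₁.biUnion N \ S with hA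
  set I : Finset V := Finset.univ.filter fun v =>
    v ∉ L ∧ v ∉ S₀ ∧ Disjoint (G.neighborFinset v) (S ∪ A) with hI
  have memI : ∀ {v}, v ∈ I ↔ v ∉ L ∧ v ∉ S₀ ∧ ∀ w ∈ S ∪ A, ¬ G.Adj v w := by
    intro v
    simp only [hI, Finset.mem_filter, Finset.mem_univ, true_and, Finset.disjoint_right,
      G.mem_neighborFinset]
  have memA : ∀ {v}, v ∈ A → v ∉ S ∧ v ∉ L ∧ ∃ s ∈ S, G.Adj v s := by
    intro v hv
    rw [hA, Finset.mem_sdiff, Finset.mem_biUnion] at hv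
    obtain ⟨⟨s, hs, hvs⟩, hvS⟩ := hv
    rw [memN] at hvs
    exact ⟨hvS, fun h => hvs.2 (memL.1 h), s, (Finset.mem_filter.1 hs).1, hvs.1.symm⟩
  have hSL : ∀ {v}, v ∈ S → v ∉ L := by
    intro v hv hvL
    obtain ⟨w, hw⟩ := memS.1 hv
    rw [mem_ℓ] at hw
    exact hleaf v w hw.1 (memL.1 hvL) hw.2
  have hN1 : ∀ {v}, v ∈ S → (N v).card = 1 → v ∉ I := by
    intro v hv hc hvI
    obtain ⟨u, hu⟩ := Finset.card_eq_one.1 hc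
    have hu' : u ∈ N v := by simp [hu]
    refine (memI.1 hvI).2.2 u ?_ (memN.1 hu').1
    by_cases huS : u ∈ S
    · exact Finset.mem_union_left _ huS
    · refine Finset.mem_union_right _ (Finset.mem_sdiff.2 ⟨Finset.mem_biUnion.2 ⟨v, ?_, hu'⟩, huS⟩)
      exact Finset.mem_filter.2 ⟨hv, hc⟩
  have hℓ0 : ∀ {v}, v ∉ S → (ℓ v).card = 0 := by
    intro v hv
    rw [Finset.card_eq_zero]
    exact Finset.not_nonempty_iff_eq_empty.1 fun h => hv (memS.2 h)
  have hsize : ∀ v ∈ I, 2 ≤ (N v).card := by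
    intro v hv
    have h1 := memI.1 hv
    have hd1 : G.degree v ≠ 1 := fun h => h1.1 (memL.2 h)
    have := hpos v
    have := hdeg v
    by_cases hvS : v ∈ S
    · have : (N v).card ≠ 1 := fun h => hN1 hvS h hv
      have : (N v).card ≠ 0 := fun h => h1.2.1 (Finset.mem_filter.2 ⟨hvS, h⟩)
      omega
    · have := hℓ0 hvS
      omega
  obtain ⟨T, hT, hTc⟩ := exists_transversal_six_mul_card_le (I.image N) (by
    intro e he
    obtain ⟨v, hv, rfl⟩ := Finset.mem_image.1 he
    exact hsize v hv)
  set X := (I.image N).biUnion id with hX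
  have memX : ∀ {v}, v ∈ X → v ∉ L ∧ v ∉ S ∧ v ∉ A := by
    intro v hv
    simp only [hX, Finset.mem_biUnion, Finset.mem_image, id] at hv
    obtain ⟨_, ⟨u, hu, rfl⟩, hvu⟩ := hv
    rw [memN] at hvu
    have := (memI.1 hu).2.2 v
    refine ⟨fun h => hvu.2 (memL.1 h), fun h => this ?_ hvu.1, fun h => this ?_ hvu.1⟩
    · exact Finset.mem_union_left _ h
    · exact Finset.mem_union_right _ h
  have hwN : ∑ e ∈ I.image N, hyperedgeWeight e ≤ ∑ v ∈ I, hyperedgeWeight (N v) :=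
    Finset.sum_image_le_of_nonneg fun _ _ => Nat.zero_le _
  have hr : ∀ s : S₀, ∃ w, w ∈ ℓ s := fun s => memS.1 (Finset.mem_filter.1 s.2).1
  choose r hr using hr
  refine ⟨S ∪ A ∪ S₀.attach.image r ∪ T, fun v => ?_, ?_⟩
  · by_cases hvI : v ∈ I
    · obtain ⟨u, hu, huT⟩ := hT (N v) (Finset.mem_image_of_mem _ hvI)
      exact ⟨u, by simp [huT], (memN.1 hu).1⟩
    by_cases hvL : v ∈ L
    · obtain ⟨s, hs⟩ := (G.degree_pos_iff_exists_adj v).1 (hpos v)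
      have : s ∈ S := memS.2 ⟨v, mem_ℓ.2 ⟨hs.symm, memL.1 hvL⟩⟩
      exact ⟨s, by simp [this], hs⟩
    by_cases hv0 : v ∈ S₀
    · refine ⟨r ⟨v, hv0⟩, ?_, (mem_ℓ.1 (hr ⟨v, hv0⟩)).1⟩
      exact Finset.mem_union_left _ (Finset.mem_union_right _
        (Finset.mem_image_of_mem _ (Finset.mem_attach _ _)))
    · have : ∃ w ∈ S ∪ A, G.Adj v w := by
        by_contra! h
        exact hvI (memI.2 ⟨hvL, hv0, h⟩)
      obtain ⟨w, hw, hvw⟩ := this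
      exact ⟨w, Finset.mem_union_left _ (Finset.mem_union_left _ hw), hvw⟩
  · have c1 := Finset.card_union_le (S ∪ A ∪ S₀.attach.image r) T
    have c2 := Finset.card_union_le (S ∪ A) (S₀.attach.image r)
    have c3 := Finset.card_union_le S A
    have c4 : (S₀.attach.image r).card ≤ S₀.card :=
      Finset.card_image_le.trans Finset.card_attach.le
    have c5 : A.card ≤ S₁.card := by
      have h1 : A.card ≤ (S₁.biUnion N).card := Finset.card_le_card Finset.sdiff_subset
      have h2 : (S₁.biUnion N).card ≤ S₁.card * 1 :=
        Finset.card_biUnion_le_card_mul _ _ _ fun s hs => (Finset.mem_filter.1 hs).2.le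
      omega
    have c6 : ∑ s ∈ S, (ℓ s).card ≤ L.card := by
      rw [← Finset.card_biUnion]
      · exact Finset.card_le_card (Finset.biUnion_subset.2 fun s _ => Finset.inter_subset_right)
      · intro s _ t _ hst
        rw [Function.onFun, Finset.disjoint_left]
        intro w hws hwt
        rw [mem_ℓ] at hws hwt
        have : 1 < (G.neighborFinset w).card := Finset.one_lt_card.2
          ⟨s, by simpa using hws.1.symm, t, by simpa using hwt.1.symm, hst⟩
        rw [G.card_neighborFinset_eq_degree] at this
        omega
    have pointwise : ∀ v, (if v ∈ S then 6 else 0) + (if v ∈ A then 3 else 0) +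
        (if v ∈ S₁ then 3 else 0) + (if v ∈ S₀ then 6 else 0) + (if v ∈ X then 2 else 0) +
        (if v ∈ I then hyperedgeWeight (N v) else 0) + (if v ∈ L then 5 else 0) ≤
        (if G.degree v = 1 then 5 else if G.degree v = 2 then 4 else 3) +
        (if v ∈ S then 5 * (ℓ v).card else 0) := by
      intro v
      have hd := hdeg v
      have hp := hpos v
      by_cases hvS : v ∈ S
      · have hvL : v ∉ L := hSL hvS
        have hvA : v ∉ A := fun h => (memA h).1 hvS
        have hvX : v ∉ X := fun h => (memX h).2.1 hvS
        have hd1 : G.degree v ≠ 1 := fun h => hvL (memL.2 h)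
        have hlp := Finset.card_pos.2 (memS.1 hvS)
        have e1 : v ∈ S₁ ↔ (N v).card = 1 := by simp [hS₁, hvS]
        have e0 : v ∈ S₀ ↔ (N v).card = 0 := by simp [hS₀, hvS]
        have hw := hyperedgeWeight_le_two (N v)
        have hi : v ∈ I → 2 ≤ (N v).card := hsize v
        simp only [hvS, hvL, hvA, hvX, hd1, e1, e0, if_true, if_false]
        split_ifs <;> first | omega | (have := hi ‹_›; omega)
      · have hv1 : v ∉ S₁ := fun h => hvS (Finset.mem_filter.1 h).1
        have hv0 : v ∉ S₀ := fun h => hvS (Finset.mem_filter.1 h).1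
        have hl := hℓ0 hvS
        by_cases hvL : v ∈ L
        · have hvA : v ∉ A := fun h => (memA h).2.1 hvL
          have hvX : v ∉ X := fun h => (memX h).1 hvL
          have hvI : v ∉ I := fun h => (memI.1 h).1 hvL
          simp [hvS, hv1, hv0, hvL, hvA, hvX, hvI, memL.1 hvL]
        · have hd1 : G.degree v ≠ 1 := fun h => hvL (memL.2 h)
          by_cases hvA : v ∈ A
          · have hvX : v ∉ X := fun h => (memX h).2.2 hvA
            have hvI : v ∉ I := fun h => by
              obtain ⟨s, hs, hvs⟩ := (memA hvA).2.2
              exact (memI.1 h).2.2 s (Finset.mem_union_left _ hs) hvs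
            simp only [hvS, hv1, hv0, hvL, hvA, hvX, hvI, hd1, if_true, if_false]
            split_ifs <;> omega
          · simp only [hvS, hv1, hv0, hvL, hvA, hd1, if_false, hyperedgeWeight]
            split_ifs <;> omega
    have total := Finset.sum_le_sum fun v (_ : v ∈ Finset.univ) => pointwise v
    simp only [Finset.sum_add_distrib, Finset.sum_ite_mem, Finset.univ_inter, Finset.sum_const,
      smul_eq_mul, ← Finset.mul_sum] at total
    omega

lemma ncard_supp_connectedComponentMk_le {V : Type*} (G : SimpleGraph V) (D : Finset V) {v : V}
    (hv : v ∈ D) (hD : ∀ u ∈ D, ∀ w, G.Adj u w → w ∈ D) :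
    (G.connectedComponentMk v).supp.ncard ≤ D.card := by
  rw [← Set.ncard_coe_finset]
  refine Set.ncard_le_ncard ?_ D.finite_toSet
  have walk : ∀ {a b : V}, G.Walk a b → a ∈ D → b ∈ D := by
    intro a b p
    induction p with
    | nil => exact id
    | cons h _ ih => exact fun ha => ih (hD _ ha _ h)
  intro w hw
  rw [SimpleGraph.ConnectedComponent.mem_supp_iff, SimpleGraph.ConnectedComponent.eq] at hw
  obtain ⟨p⟩ := hw.symm
  exact walk p hv

/-- If every component of `G` has order at least 3, then `m ≤ Δ(n − γt)`, where `Δ = 3` if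
`Δ(G) = 2` and `Δ = Δ(G)` if `Δ(G) ≥ 3`. -/
theorem size_le_Delta_mul_order_sub_totalDominationNumber
    {V : Type*} [Fintype V] [DecidableEq V] (G : SimpleGraph V) [DecidableRel G.Adj]
    (hcomp : ∀ c : G.ConnectedComponent, 3 ≤ c.supp.ncard)
    (Δ : ℕ) (hΔ2 : G.maxDegree = 2 → Δ = 3) (hΔ3 : 3 ≤ G.maxDegree → Δ = G.maxDegree) :
    G.edgeFinset.card ≤ Δ * (Fintype.card V - totalDominationNumber G) := by
  have eq_of_adj : ∀ {u v w}, G.degree u = 1 → G.Adj u v → G.Adj u w → w = v := by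
    intro u v w hu huv huw
    rw [← G.card_neighborFinset_eq_degree] at hu
    exact Finset.card_le_one.1 hu.le w (by simpa using huw) v (by simpa using huv)
  have hpos : ∀ v, 1 ≤ G.degree v := by
    intro v
    rw [Nat.one_le_iff_ne_zero, ← Nat.pos_iff_ne_zero, G.degree_pos_iff_exists_adj]
    by_contra! h
    have h1 := ncard_supp_connectedComponentMk_le G {v} (Finset.mem_singleton_self v)
      (fun u hu w huw => absurd (Finset.mem_singleton.1 hu ▸ huw) (h w))
    have h2 := hcomp (G.connectedComponentMk v)
    rw [Finset.card_singleton] at h1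
    omega
  have hleaf : ∀ u v, G.Adj u v → G.degree u = 1 → G.degree v ≠ 1 := by
    intro u v huv hu hv
    have h1 := ncard_supp_connectedComponentMk_le G {u, v} (v := u) (by simp) (by
      intro a ha w haw
      simp only [Finset.mem_insert, Finset.mem_singleton] at ha ⊢
      rcases ha with rfl | rfl
      · exact Or.inr (eq_of_adj hu huv haw)
      · exact Or.inl (eq_of_adj hv huv.symm haw))
    have h2 := hcomp (G.connectedComponentMk u)
    have h3 := Finset.card_le_two (a := u) (b := v)
    omega
  rcases isEmpty_or_nonempty V with hV | ⟨⟨x⟩⟩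
  · have : G.edgeFinset.card = 0 := by
      have := G.sum_degrees_eq_twice_card_edges
      simpa using this
    omega
  have hmax2 : 2 ≤ G.maxDegree := by
    by_contra! h
    have h1 : ∀ v, G.degree v = 1 := fun v => by
      have := hpos v
      have := G.degree_le_maxDegree v
      omega
    obtain ⟨y, hy⟩ := (G.degree_pos_iff_exists_adj x).1 (hpos x)
    exact hleaf x y hy (h1 x) (h1 y)
  have hΔ : 3 ≤ Δ ∧ G.maxDegree ≤ Δ := by
    rcases hmax2.eq_or_lt with h | h
    · have := hΔ2 h.symm
      omega
    · have := hΔ3 h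
      omega
  obtain ⟨T, hT, hTc⟩ := exists_totalDominating_six_mul_card_le G hpos hleaf
  have hγ : totalDominationNumber G ≤ T.card := Nat.sInf_le ⟨T, rfl, hT⟩
  have hTn : T.card ≤ Fintype.card V := T.card_le_univ
  have pointwise : ∀ v, Δ * (if G.degree v = 1 then 5 else if G.degree v = 2 then 4 else 3) +
      3 * G.degree v ≤ 6 * Δ := by
    intro v
    have := hpos v
    have := G.degree_le_maxDegree v
    split_ifs <;> omega
  have total := Finset.sum_le_sum fun v (_ : v ∈ Finset.univ) => pointwise v
  rw [Finset.sum_add_distrib, ← Finset.mul_sum, ← Finset.mul_sum,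
    G.sum_degrees_eq_twice_card_edges, Finset.sum_const, smul_eq_mul, Finset.card_univ] at total
  have hmul := Nat.mul_le_mul_left Δ hTc
  obtain ⟨k, hk⟩ := Nat.exists_eq_add_of_le (hγ.trans hTn)
  rw [hk, Nat.add_sub_cancel_left]
  have hmulγ := Nat.mul_le_mul_left Δ hγ
  rw [hk] at total
  nlinarith
end

section
/- Let G be a finite simple graph of order n, size m, total domination number γt, and maximum degree Δ(G), and set Δ = 3 if Δ(G) = 2 and Δ = Δ(G) if Δ(G) ≥ 3. If G is isomorphic to one of the graphs C_k ∘ P_2 (k ≥ 3), F_k (k ≥ 0), L_k (k ≥ 0), G_k (k ≥ 1), H_k (k ≥ 2), or GP_16, then m = Δ(n − γt). -/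
open SimpleGraph

section TotalDomination

variable {V : Type*}

theorem totalDominationNumber_le [Fintype V] (G : SimpleGraph V) (S : Finset V)
    (hS : ∀ v : V, ∃ u ∈ S, G.Adj v u) : totalDominationNumber G ≤ S.card :=
  Nat.sInf_le ⟨S, rfl, hS⟩

theorem totalDominationNumber_eq [Fintype V] (G : SimpleGraph V) (t : ℕ) (S : Finset V) (hcard : S.card = t)
    (hS : ∀ v : V, ∃ u ∈ S, G.Adj v u)
    (hmin : ∀ T : Finset V, (∀ v : V, ∃ u ∈ T, G.Adj v u) → t ≤ T.card) :
    totalDominationNumber G = t := by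
  refine le_antisymm (hcard ▸ totalDominationNumber_le G S hS) ?_
  refine le_csInf ⟨_, S, rfl, hS⟩ ?_
  rintro _ ⟨T, rfl, hT⟩
  exact hmin T hT

theorem totalDominationNumber_congr [Fintype V] {W : Type*} [Fintype W] {G : SimpleGraph V}
    {H : SimpleGraph W} (e : G ≃g H) : totalDominationNumber G = totalDominationNumber H := by
  unfold totalDominationNumber
  congr 1
  ext n
  constructor
  · rintro ⟨S, rfl, hS⟩
    refine ⟨S.map e.toEquiv.toEmbedding, Finset.card_map _, fun w => ?_⟩
    obtain ⟨u, hu, h⟩ := hS (e.symm w)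
    exact ⟨e u, Finset.mem_map_of_mem _ hu, by simpa using e.map_adj_iff.2 h⟩
  · rintro ⟨S, rfl, hS⟩
    refine ⟨S.map e.symm.toEquiv.toEmbedding, Finset.card_map _, fun w => ?_⟩
    obtain ⟨u, hu, h⟩ := hS (e w)
    exact ⟨e.symm u, Finset.mem_map_of_mem _ hu, by simpa using e.symm.map_adj_iff.2 h⟩

/-- If the cells `0, …, N - 1` of a labelling `κ` are such that every empty cell forces two
elements in a cell chosen injectively, then there are at least `N` elements. -/
theorem le_card_of_cells (S : Finset V) (N : ℕ) (κ : V → ℕ) (σ : ℕ → ℕ)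
    (hσ : ∀ n < N, σ n < N) (hinj : ∀ m < N, ∀ n < N, σ m = σ n → m = n)
    (h : ∀ n < N, (∀ v ∈ S, κ v ≠ n) → ∃ x ∈ S, ∃ y ∈ S, x ≠ y ∧ κ x = σ n ∧ κ y = σ n) :
    N ≤ S.card := by
  classical
  set w : ℕ → ℕ := fun n => (S.filter (fun v => κ v = n)).card with hw
  set E := (Finset.range N).filter (fun n => w n = 0) with hE
  set D := (Finset.range N).filter (fun n => 2 ≤ w n) with hD
  have hED : E.card ≤ D.card := by
    refine Finset.card_le_card_of_injOn σ (fun n hn => ?_) (fun m hm n hn hmn => ?_)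
    · simp only [hE, Finset.coe_filter, Finset.mem_range, Set.mem_ofPred_eq] at hn
      obtain ⟨hn, h0⟩ := hn
      have h0 : ∀ v ∈ S, κ v ≠ n := by
        simpa [hw, Finset.filter_eq_empty_iff] using h0
      obtain ⟨x, hx, y, hy, hxy, hκx, hκy⟩ := h n hn h0
      simp only [hD, Finset.coe_filter, Finset.mem_range, Set.mem_ofPred_eq]
      refine ⟨hσ n hn, ?_⟩
      exact Finset.one_lt_card.2 ⟨x, by simp [hx, hκx], y, by simp [hy, hκy], hxy⟩
    · simp only [hE, Finset.coe_filter, Finset.mem_range, Set.mem_ofPred_eq] at hm hn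
      exact hinj m hm.1 n hn.1 hmn
  have hsum : ∑ n ∈ Finset.range N, (1 + if 2 ≤ w n then 1 else 0) ≤
      ∑ n ∈ Finset.range N, (w n + if w n = 0 then 1 else 0) := by
    refine Finset.sum_le_sum fun n _ => ?_
    split_ifs <;> omega
  have hwS : ∑ n ∈ Finset.range N, w n ≤ S.card := by
    rw [← Finset.card_biUnion]
    · exact Finset.card_le_card fun v hv => by
        simp only [Finset.mem_biUnion, Finset.mem_filter] at hv
        exact hv.choose_spec.2.1
    · intro m _ n _ hmn
      refine Finset.disjoint_left.2 fun v hv hv' => hmn ?_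
      rw [← (Finset.mem_filter.1 hv).2, (Finset.mem_filter.1 hv').2]
  rw [Finset.sum_add_distrib, Finset.sum_add_distrib, ← Finset.card_filter, ← Finset.card_filter]
    at hsum
  simp only [Finset.sum_const, Finset.card_range, smul_eq_mul, mul_one] at hsum
  change N + D.card ≤ _ + E.card at hsum
  omega

/-- A lower bound for total dominating sets: each cell contains a whole open neighborhood, or
misses only one vertex from each of two open neighborhoods, these vertices being distinct and
lying in a common cell chosen injectively. -/
theorem le_card_of_neighborhood_cells (G : SimpleGraph V) (N : ℕ) (κ : V → ℕ) (σ : ℕ → ℕ)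
    (hσ : ∀ n < N, σ n < N) (hinj : ∀ m < N, ∀ n < N, σ m = σ n → m = n)
    (h : ∀ n < N, (∃ v, ∀ u, G.Adj v u → κ u = n) ∨
      ∃ v v' x y, x ≠ y ∧ κ x = σ n ∧ κ y = σ n ∧
        (∀ u, G.Adj v u → κ u = n ∨ u = x) ∧ (∀ u, G.Adj v' u → κ u = n ∨ u = y))
    (S : Finset V) (hS : ∀ v : V, ∃ u ∈ S, G.Adj v u) : N ≤ S.card := by
  refine le_card_of_cells S N κ σ hσ hinj fun n hn h0 => ?_
  rcases h n hn with ⟨v, hv⟩ | ⟨v, v', x, y, hxy, hx, hy, hv, hv'⟩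
  · obtain ⟨u, hu, huv⟩ := hS v
    exact absurd (hv u huv) (h0 u hu)
  · obtain ⟨u, hu, huv⟩ := hS v
    obtain ⟨u', hu', huv'⟩ := hS v'
    obtain rfl := (hv u huv).resolve_left (h0 u hu)
    obtain rfl := (hv' u' huv').resolve_left (h0 u' hu')
    exact ⟨u, hu, u', hu', hxy, hx, hy⟩

theorem SimpleGraph.degree_eq_three_of_adj_iff [Fintype V] {G : SimpleGraph V} [DecidableRel G.Adj]
    {v x y z : V} (h : ∀ u, G.Adj v u ↔ u = x ∨ u = y ∨ u = z) (hxy : x ≠ y) (hxz : x ≠ z)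
    (hyz : y ≠ z) : G.degree v = 3 := by
  classical
  rw [← G.card_neighborFinset_eq_degree, ← Finset.card_eq_three.2 ⟨x, y, z, hxy, hxz, hyz, rfl⟩]
  congr 1
  ext u
  simp [h]

theorem SimpleGraph.degree_eq_two_of_adj_iff [Fintype V] {G : SimpleGraph V} [DecidableRel G.Adj]
    {v x y : V} (h : ∀ u, G.Adj v u ↔ u = x ∨ u = y) (hxy : x ≠ y) : G.degree v = 2 := by
  classical
  rw [← G.card_neighborFinset_eq_degree, ← Finset.card_pair hxy]
  congr 1
  ext u
  simp [h]

theorem SimpleGraph.degree_eq_one_of_adj_iff [Fintype V] {G : SimpleGraph V} [DecidableRel G.Adj]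
    {v x : V} (h : ∀ u, G.Adj v u ↔ u = x) : G.degree v = 1 := by
  classical
  rw [← G.card_neighborFinset_eq_degree, ← Finset.card_singleton x]
  congr 1
  ext u
  simp [h]

theorem card_edgeFinset_eq_of_iso {W : Type*} [Fintype V] [Fintype W] {G : SimpleGraph V}
    [DecidableRel G.Adj] {H : SimpleGraph W} [DecidableRel H.Adj] (e : G ≃g H) {Δ : ℕ}
    (hΔ2 : G.maxDegree = 2 → Δ = 3) (hΔ3 : 3 ≤ G.maxDegree → Δ = G.maxDegree)
    (hle : ∀ w, H.degree w ≤ 3) (hge : ∃ w, 2 ≤ H.degree w)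
    (hsum : ∑ w, H.degree w = 2 * (3 * (Fintype.card W - totalDominationNumber H))) :
    G.edgeFinset.card = Δ * (Fintype.card V - totalDominationNumber G) := by
  have hmax : G.maxDegree = H.maxDegree := e.maxDegree_eq
  have hm : G.edgeFinset.card = H.edgeFinset.card := e.card_edgeFinset_eq
  have h3 : H.maxDegree ≤ 3 := H.maxDegree_le_of_forall_degree_le 3 hle
  have h2 : 2 ≤ H.maxDegree := hge.elim fun w hw => hw.trans (H.degree_le_maxDegree w)
  have hΔ : Δ = 3 := by
    rcases (by omega : G.maxDegree = 2 ∨ G.maxDegree = 3) with h | h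
    · exact hΔ2 h
    · rw [hΔ3 h.ge, h]
  have := H.sum_degrees_eq_twice_card_edges
  rw [hm, hΔ, totalDominationNumber_congr e, Fintype.card_congr e.toEquiv]
  omega

end TotalDomination

section Ladder

variable {V : Type*} {k : ℕ}

/-- The neighbor outside its own 4-cycle of a vertex of a chain of 4-cycles placed in `V` by `f`,
where `s` gives these neighbors for the two vertices at each end of the chain. -/
def ladderNext (f : Fin 4 × Fin k → V) (s : Fin 4 → V) (p : Fin 4 × Fin k) : V :=
  if p.1 = 0 ∨ p.1 = 2 then
    if (p.2 : ℕ) = 0 then s p.1 else f (p.1 + 1, ⟨p.2 - 1, by omega⟩)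
  else
    if h : (p.2 : ℕ) + 1 = k then s p.1 else f (p.1 + 3, ⟨p.2 + 1, by omega⟩)

def gkEnd (hk : 1 ≤ k) : Fin 4 → Fin 4 × Fin k :=
  ![(2, ⟨0, hk⟩), (3, ⟨k - 1, by omega⟩), (0, ⟨0, hk⟩), (1, ⟨k - 1, by omega⟩)]

def hkEnd (hk : 1 ≤ k) : Fin 4 → Fin 4 × Fin k :=
  ![(1, ⟨k - 1, by omega⟩), (0, ⟨0, hk⟩), (3, ⟨k - 1, by omega⟩), (2, ⟨0, hk⟩)]

theorem GkGraph_adj (hk : 1 ≤ k) (p u : Fin 4 × Fin k) :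
    (GkGraph k).Adj p u ↔
      u = (p.1 + 1, p.2) ∨ u = (p.1 + 3, p.2) ∨ u = ladderNext id (gkEnd hk) p := by
  obtain ⟨j, i, hi⟩ := p
  obtain ⟨l, m, hm⟩ := u
  fin_cases j <;> fin_cases l <;>
  · simp [GkGraph, gkRel, gkBase, ladderNext, gkEnd]
    try split_ifs
    all_goals simp
    all_goals omega

theorem HkGraph_adj (hk : 2 ≤ k) (p u : Fin 4 × Fin k) :
    (HkGraph k).Adj p u ↔ u = (p.1 + 1, p.2) ∨ u = (p.1 + 3, p.2) ∨
      u = ladderNext id (hkEnd (one_le_two.trans hk)) p := by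
  obtain ⟨j, i, hi⟩ := p
  obtain ⟨l, m, hm⟩ := u
  fin_cases j <;> fin_cases l <;>
  · simp [HkGraph, hkRel, gkBase, ladderNext, hkEnd]
    try split_ifs
    all_goals simp
    all_goals omega

def fkEnd (hk : 1 ≤ k) : Fin 4 → FkVert k :=
  ![Sum.inr 0, Sum.inl (3, ⟨k - 1, by omega⟩), Sum.inr 2, Sum.inl (1, ⟨k - 1, by omega⟩)]

def lkEnd (k : ℕ) : Fin 4 → LkVert k :=
  ![Sum.inr (0, 0), Sum.inr (1, 0), Sum.inr (0, 2), Sum.inr (1, 2)]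

theorem FkGraph_adj_inl (hk : 1 ≤ k) (p : Fin 4 × Fin k) (u : FkVert k) :
    (FkGraph k).Adj (Sum.inl p) u ↔ u = Sum.inl (p.1 + 1, p.2) ∨ u = Sum.inl (p.1 + 3, p.2) ∨
      u = ladderNext Sum.inl (fkEnd hk) p := by
  obtain ⟨j, i, hi⟩ := p
  obtain ⟨l, m, hm⟩ | l := u <;> fin_cases j <;> fin_cases l <;>
  · simp [FkGraph, fkRel, gkBase, ladderNext, fkEnd]
    try split_ifs
    all_goals simp
    all_goals omega

theorem LkGraph_adj_inl (p : Fin 4 × Fin k) (u : LkVert k) :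
    (LkGraph k).Adj (Sum.inl p) u ↔ u = Sum.inl (p.1 + 1, p.2) ∨ u = Sum.inl (p.1 + 3, p.2) ∨
      u = ladderNext Sum.inl (lkEnd k) p := by
  obtain ⟨j, i, hi⟩ := p
  obtain ⟨l, m, hm⟩ | l := u <;> fin_cases j <;> fin_cases l <;>
  · simp [LkGraph, lkRel, gkBase, ladderNext, lkEnd]
    try split_ifs
    all_goals try simp
    all_goals omega

theorem FkGraph_adj_inr (hk : 1 ≤ k) (j : Fin 3) (u : FkVert k) :
    (FkGraph k).Adj (Sum.inr j) u ↔
      u = ![Sum.inl (0, ⟨0, hk⟩), Sum.inr 0, Sum.inl (2, ⟨0, hk⟩)] j ∨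
      u = ![Sum.inr 1, Sum.inr 2, Sum.inr 1] j := by
  obtain ⟨l, m, hm⟩ | l := u <;> fin_cases j <;> fin_cases l <;>
  simp [FkGraph, fkRel]

theorem LkGraph_adj_inr (hk : 1 ≤ k) (j : Fin 2 × Fin 3) (u : LkVert k) :
    (LkGraph k).Adj (Sum.inr j) u ↔
      u = ![![Sum.inl (0, ⟨0, hk⟩), Sum.inr (0, 0), Sum.inl (2, ⟨0, hk⟩)],
        ![Sum.inl (1, ⟨k - 1, by omega⟩), Sum.inr (1, 0), Sum.inl (3, ⟨k - 1, by omega⟩)]] j.1 j.2 ∨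
      u = Sum.inr (j.1, ![1, 2, 1] j.2) := by
  obtain ⟨l, m, hm⟩ | l := u <;> fin_cases j <;> fin_cases l <;>
  simp [LkGraph, lkRel]

theorem coronaGraph_adj_zero (hk : 3 ≤ k) (i : Fin k) (u : Fin 3 × Fin k) :
    (coronaGraph k).Adj (0, i) u ↔ u = (1, i) ∨
      u = (0, if h : (i : ℕ) + 1 = k then ⟨0, by omega⟩ else ⟨i + 1, by omega⟩) ∨
      u = (0, if (i : ℕ) = 0 then ⟨k - 1, by omega⟩ else ⟨i - 1, by omega⟩) := by
  have hmod : ∀ a < k, (a + 1) % k = if a + 1 = k then 0 else a + 1 := fun a ha => by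
    split_ifs with h
    · rw [h, Nat.mod_self]
    · exact Nat.mod_eq_of_lt (by omega)
  obtain ⟨i, hi⟩ := i
  obtain ⟨l, m, hm⟩ := u
  fin_cases l <;> simp [coronaGraph, coronaRel, hmod i hi, hmod m hm]
  · split_ifs
    all_goals simp
    all_goals omega
  · omega

theorem coronaGraph_adj_one (i : Fin k) (u : Fin 3 × Fin k) :
    (coronaGraph k).Adj (1, i) u ↔ u = (0, i) ∨ u = (2, i) := by
  obtain ⟨i, hi⟩ := i
  obtain ⟨l, m, hm⟩ := u
  fin_cases l <;> simp [coronaGraph, coronaRel]; omega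

theorem coronaGraph_adj_two (i : Fin k) (u : Fin 3 × Fin k) :
    (coronaGraph k).Adj (2, i) u ↔ u = (1, i) := by
  obtain ⟨i, hi⟩ := i
  obtain ⟨l, m, hm⟩ := u
  fin_cases l <;> simp [coronaGraph, coronaRel]

theorem ladder_degree [Fintype V] {G : SimpleGraph V} [DecidableRel G.Adj]
    {f : Fin 4 × Fin k → V} {s : Fin 4 → V} (hf : Function.Injective f) (p : Fin 4 × Fin k)
    (hadj : ∀ u, G.Adj (f p) u ↔
      u = f (p.1 + 1, p.2) ∨ u = f (p.1 + 3, p.2) ∨ u = ladderNext f s p)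
    (h₁ : f (p.1 + 1, p.2) ≠ ladderNext f s p) (h₃ : f (p.1 + 3, p.2) ≠ ladderNext f s p) :
    G.degree (f p) = 3 :=
  SimpleGraph.degree_eq_three_of_adj_iff hadj (hf.ne (by simp)) h₁ h₃

theorem GkGraph_degree (hk : 1 ≤ k) [DecidableRel (GkGraph k).Adj] (p : Fin 4 × Fin k) :
    (GkGraph k).degree p = 3 := by
  apply ladder_degree Function.injective_id p (GkGraph_adj hk p) <;>
  · obtain ⟨j, i, hi⟩ := p
    fin_cases j <;> simp [ladderNext, gkEnd] <;> split_ifs <;> simp <;> omega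

theorem HkGraph_degree (hk : 2 ≤ k) [DecidableRel (HkGraph k).Adj] (p : Fin 4 × Fin k) :
    (HkGraph k).degree p = 3 := by
  apply ladder_degree Function.injective_id p (HkGraph_adj hk p) <;>
  · obtain ⟨j, i, hi⟩ := p
    fin_cases j <;> simp [ladderNext, hkEnd] <;> split_ifs <;> simp <;> omega

theorem FkGraph_degree_inl (hk : 1 ≤ k) [DecidableRel (FkGraph k).Adj] (p : Fin 4 × Fin k) :
    (FkGraph k).degree (Sum.inl p) = 3 := by
  apply ladder_degree Sum.inl_injective p (FkGraph_adj_inl hk p) <;>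
  · obtain ⟨j, i, hi⟩ := p
    fin_cases j <;> simp [ladderNext, fkEnd] <;> split_ifs <;> simp <;> omega

theorem LkGraph_degree_inl [DecidableRel (LkGraph k).Adj] (p : Fin 4 × Fin k) :
    (LkGraph k).degree (Sum.inl p) = 3 := by
  apply ladder_degree Sum.inl_injective p (LkGraph_adj_inl p) <;>
  · obtain ⟨j, i, hi⟩ := p
    fin_cases j <;> simp [ladderNext, lkEnd] <;> split_ifs <;> simp <;> omega

theorem FkGraph_degree_inr (hk : 1 ≤ k) [DecidableRel (FkGraph k).Adj] (j : Fin 3) :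
    (FkGraph k).degree (Sum.inr j) = 2 :=
  SimpleGraph.degree_eq_two_of_adj_iff (FkGraph_adj_inr hk j) (by fin_cases j <;> simp)

theorem LkGraph_degree_inr (hk : 1 ≤ k) [DecidableRel (LkGraph k).Adj] (j : Fin 2 × Fin 3) :
    (LkGraph k).degree (Sum.inr j) = 2 :=
  SimpleGraph.degree_eq_two_of_adj_iff (LkGraph_adj_inr hk j) (by fin_cases j <;> simp)

/-- The middle two rows dominate the whole chain of 4-cycles. -/
theorem exists_ladder_hub (p : Fin 4 × Fin k) :
    ∃ q ∈ ({1, 2} : Finset (Fin 4)) ×ˢ (Finset.univ : Finset (Fin k)),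
      q = (p.1 + 1, p.2) ∨ q = (p.1 + 3, p.2) := by
  obtain ⟨j, i⟩ := p
  fin_cases j
  exacts [⟨(1, i), by simp⟩, ⟨(2, i), by simp⟩, ⟨(1, i), by simp⟩, ⟨(2, i), by simp⟩]

/-- Numbers the pairs `{b_i, d_i}` in increasing order as `0, …, k - 1` and then the pairs
`{a_i, c_i}` in decreasing order as `k, …, 2 * k - 1`. -/
def ladderCell (p : Fin 4 × Fin k) : ℕ :=
  if p.1 = 1 ∨ p.1 = 3 then p.2 else 2 * k - 1 - p.2

theorem exists_pair_of_ladder {G : SimpleGraph V} {f : Fin 4 × Fin k → V} {s : Fin 4 → V}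
    (hadj : ∀ p u, G.Adj (f p) u ↔
      u = f (p.1 + 1, p.2) ∨ u = f (p.1 + 3, p.2) ∨ u = ladderNext f s p)
    (κ : V → ℕ) (p : Fin 4 × Fin k) {m n : ℕ} (h₁ : κ (f (p.1 + 1, p.2)) = n)
    (h₃ : κ (f (p.1 + 3, p.2)) = n) (hne : ladderNext f s p ≠ ladderNext f s (p.1 + 2, p.2))
    (hx : κ (ladderNext f s p) = m) (hy : κ (ladderNext f s (p.1 + 2, p.2)) = m) :
    ∃ v v' x y, x ≠ y ∧ κ x = m ∧ κ y = m ∧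
      (∀ u, G.Adj v u → κ u = n ∨ u = x) ∧ (∀ u, G.Adj v' u → κ u = n ∨ u = y) := by
  refine ⟨f p, f (p.1 + 2, p.2), _, _, hne, hx, hy, fun u hu => ?_, fun u hu => ?_⟩
  · rcases (hadj _ u).1 hu with rfl | rfl | rfl <;> simp [h₁, h₃]
  · have h : ∀ j : Fin 4, j + 2 + 1 = j + 3 ∧ j + 2 + 3 = j + 1 := by decide
    rcases (hadj _ u).1 hu with rfl | rfl | rfl <;> simp [h, h₁, h₃]

theorem totalDominationNumber_GkGraph (hk : 1 ≤ k) :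
    totalDominationNumber (GkGraph k) = 2 * k := by
  refine totalDominationNumber_eq _ _ ({1, 2} ×ˢ Finset.univ) (by simp) (fun p => ?_)
    (le_card_of_neighborhood_cells _ _ ladderCell
      (fun n => if n = 0 then 2 * k - 1 else n - 1) ?_ ?_ fun n hn => Or.inr ?_)
  · obtain ⟨q, hq, h⟩ := exists_ladder_hub p
    exact ⟨q, hq, (GkGraph_adj hk p q).2 (by tauto)⟩
  · intro n hn
    split_ifs <;> omega
  · intro m hm n hn
    split_ifs <;> omega
  · by_cases hnk : n < k
    · apply exists_pair_of_ladder (GkGraph_adj hk) ladderCell (0, ⟨n, hnk⟩) <;>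
      simp [ladderNext, gkEnd, ladderCell] <;> split_ifs <;> simp_all
    · have hi : 2 * k - 1 - n < k := by omega
      apply exists_pair_of_ladder (GkGraph_adj hk) ladderCell (1, ⟨_, hi⟩) <;>
      simp [ladderNext, gkEnd, ladderCell] <;> (try split_ifs) <;> simp_all <;> omega

theorem totalDominationNumber_HkGraph (hk : 2 ≤ k) :
    totalDominationNumber (HkGraph k) = 2 * k := by
  refine totalDominationNumber_eq _ _ ({1, 2} ×ˢ Finset.univ) (by simp) (fun p => ?_)
    (le_card_of_neighborhood_cells _ _ ladderCell
      (fun n => if n = 0 then k - 1 else if n = k then 2 * k - 1 else n - 1) ?_ ?_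
      fun n hn => Or.inr ?_)
  · obtain ⟨q, hq, h⟩ := exists_ladder_hub p
    exact ⟨q, hq, (HkGraph_adj hk p q).2 (by tauto)⟩
  · intro n hn
    split_ifs <;> omega
  · intro m hm n hn
    split_ifs <;> omega
  · by_cases hnk : n < k
    · apply exists_pair_of_ladder (HkGraph_adj hk) ladderCell (0, ⟨n, hnk⟩) <;>
      simp [ladderNext, hkEnd, ladderCell] <;> split_ifs <;> simp_all <;> omega
    · have hi : 2 * k - 1 - n < k := by omega
      apply exists_pair_of_ladder (HkGraph_adj hk) ladderCell (1, ⟨_, hi⟩) <;>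
      simp [ladderNext, hkEnd, ladderCell] <;> (try split_ifs) <;> simp_all <;> omega

def fkCell : FkVert k → ℕ :=
  Sum.elim (fun p => ladderCell p + 1) ![0, 2 * k + 1, 0]

theorem totalDominationNumber_FkGraph (hk : 1 ≤ k) :
    totalDominationNumber (FkGraph k) = 2 * k + 2 := by
  refine totalDominationNumber_eq _ _ (({1, 2} ×ˢ Finset.univ).disjSum {0, 1}) (by simp)
    (fun p => ?_) (le_card_of_neighborhood_cells _ _ fkCell
      (fun n => if n = 0 then 2 * k + 1 else n - 1) ?_ ?_ fun n hn => ?_)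
  · obtain p | j := p
    · obtain ⟨q, hq, h⟩ := exists_ladder_hub p
      refine ⟨Sum.inl q, Finset.inl_mem_disjSum.2 hq, (FkGraph_adj_inl hk p _).2 ?_⟩
      rcases h with rfl | rfl <;> simp
    · refine ⟨Sum.inr (![1, 0, 1] j), ?_, (FkGraph_adj_inr hk j _).2 ?_⟩ <;>
      fin_cases j <;> simp
  · intro n hn
    split_ifs <;> omega
  · intro m hm n hn
    split_ifs <;> omega
  · by_cases h0 : n = 0
    · refine Or.inl ⟨Sum.inr 1, fun u hu => ?_⟩
      rcases (FkGraph_adj_inr hk _ u).1 hu with rfl | rfl <;> simp [fkCell, h0]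
    right
    by_cases hlast : n = 2 * k + 1
    · refine ⟨Sum.inr 0, Sum.inr 2, Sum.inl (0, ⟨0, hk⟩), Sum.inl (2, ⟨0, hk⟩), by simp,
        ?_, ?_, fun u hu => ?_, fun u hu => ?_⟩
      · simp [fkCell, ladderCell, h0]; omega
      · simp [fkCell, ladderCell, h0]; omega
      · rcases (FkGraph_adj_inr hk _ u).1 hu with rfl | rfl <;> simp [fkCell, hlast]
      · rcases (FkGraph_adj_inr hk _ u).1 hu with rfl | rfl <;> simp [fkCell, hlast]
    by_cases hnk : n - 1 < k
    · apply exists_pair_of_ladder (FkGraph_adj_inl hk) fkCell (0, ⟨_, hnk⟩) <;>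
      simp [ladderNext, fkEnd, ladderCell, fkCell] <;> (try split_ifs) <;> (try simp_all) <;> omega
    · have hi : 2 * k - n < k := by omega
      apply exists_pair_of_ladder (FkGraph_adj_inl hk) fkCell (1, ⟨_, hi⟩) <;>
      simp [ladderNext, fkEnd, ladderCell, fkCell] <;> (try split_ifs) <;> (try simp_all) <;> omega

def lkCell : LkVert k → ℕ :=
  Sum.elim (fun p => ladderCell p + if p.1 = 1 ∨ p.1 = 3 then 1 else 3)
    fun j => ![![0, 2 * k + 3, 0], ![k + 2, k + 1, k + 2]] j.1 j.2

theorem totalDominationNumber_LkGraph (hk : 1 ≤ k) :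
    totalDominationNumber (LkGraph k) = 2 * k + 4 := by
  refine totalDominationNumber_eq _ _
    (({1, 2} ×ˢ Finset.univ).disjSum (Finset.univ ×ˢ {0, 1})) (by simp)
    (fun p => ?_) (le_card_of_neighborhood_cells _ _ lkCell
      (fun n => if n = 0 then 2 * k + 3 else n - 1) ?_ ?_ fun n hn => ?_)
  · obtain p | j := p
    · obtain ⟨q, hq, h⟩ := exists_ladder_hub p
      refine ⟨Sum.inl q, Finset.inl_mem_disjSum.2 hq, (LkGraph_adj_inl p _).2 ?_⟩
      rcases h with rfl | rfl <;> simp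
    · refine ⟨Sum.inr (j.1, ![1, 0, 1] j.2), ?_, (LkGraph_adj_inr hk j _).2 ?_⟩ <;>
      fin_cases j <;> simp
  · intro n hn
    split_ifs <;> omega
  · intro m hm n hn
    split_ifs <;> omega
  · by_cases h0 : n = 0
    · refine Or.inl ⟨Sum.inr (0, 1), fun u hu => ?_⟩
      rcases (LkGraph_adj_inr hk _ u).1 hu with rfl | rfl <;> simp [lkCell, h0]
    by_cases hmid : n = k + 2
    · refine Or.inl ⟨Sum.inr (1, 1), fun u hu => ?_⟩
      rcases (LkGraph_adj_inr hk _ u).1 hu with rfl | rfl <;> simp [lkCell, hmid]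
    right
    by_cases hlast : n = 2 * k + 3
    · refine ⟨Sum.inr (0, 0), Sum.inr (0, 2), Sum.inl (0, ⟨0, hk⟩), Sum.inl (2, ⟨0, hk⟩),
        by simp, ?_, ?_, fun u hu => ?_, fun u hu => ?_⟩
      · simp [lkCell, ladderCell, h0]; omega
      · simp [lkCell, ladderCell, h0]; omega
      · rcases (LkGraph_adj_inr hk _ u).1 hu with rfl | rfl <;> simp [lkCell, hlast]
      · rcases (LkGraph_adj_inr hk _ u).1 hu with rfl | rfl <;> simp [lkCell, hlast]
    by_cases hend : n = k + 1
    · refine ⟨Sum.inr (1, 0), Sum.inr (1, 2), Sum.inl (1, ⟨k - 1, by omega⟩),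
        Sum.inl (3, ⟨k - 1, by omega⟩), by simp, ?_, ?_, fun u hu => ?_, fun u hu => ?_⟩
      · simp [lkCell, ladderCell, h0]; omega
      · simp [lkCell, ladderCell, h0]; omega
      · rcases (LkGraph_adj_inr hk _ u).1 hu with rfl | rfl <;> simp [lkCell, hend]
      · rcases (LkGraph_adj_inr hk _ u).1 hu with rfl | rfl <;> simp [lkCell, hend]
    by_cases hnk : n - 1 < k
    · apply exists_pair_of_ladder LkGraph_adj_inl lkCell (0, ⟨_, hnk⟩) <;>
      simp [ladderNext, lkEnd, ladderCell, lkCell] <;> (try split_ifs) <;> (try simp_all) <;> omega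
    · have hi : 2 * k + 2 - n < k := by omega
      apply exists_pair_of_ladder LkGraph_adj_inl lkCell (1, ⟨_, hi⟩) <;>
      simp [ladderNext, lkEnd, ladderCell, lkCell] <;> (try split_ifs) <;> (try simp_all) <;> omega

end Ladder

section Corona

variable {k : ℕ}

theorem totalDominationNumber_coronaGraph (hk : 3 ≤ k) :
    totalDominationNumber (coronaGraph k) = 2 * k := by
  refine totalDominationNumber_eq _ _ ({0, 1} ×ˢ Finset.univ) (by simp) (fun p => ?_)
    (le_card_of_neighborhood_cells _ _ (fun p => if p.1 = 1 then (p.2 : ℕ) else k + p.2) id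
      (by simp) (by simp) fun n hn => Or.inl ?_)
  · obtain ⟨j, i⟩ := p
    fin_cases j
    · exact ⟨(1, i), by simp, (coronaGraph_adj_zero hk i _).2 (by simp)⟩
    · exact ⟨(0, i), by simp, (coronaGraph_adj_one i _).2 (by simp)⟩
    · exact ⟨(1, i), by simp, (coronaGraph_adj_two i _).2 (by simp)⟩
  · by_cases hnk : n < k
    · refine ⟨(2, ⟨n, hnk⟩), fun u hu => ?_⟩
      obtain rfl := (coronaGraph_adj_two _ u).1 hu
      simp
    · refine ⟨(1, ⟨n - k, by omega⟩), fun u hu => ?_⟩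
      rcases (coronaGraph_adj_one _ u).1 hu with rfl | rfl <;> simp <;> omega

theorem coronaGraph_degree (hk : 3 ≤ k) [DecidableRel (coronaGraph k).Adj] (p : Fin 3 × Fin k) :
    (coronaGraph k).degree p = 3 - p.1 := by
  obtain ⟨j, i⟩ := p
  fin_cases j
  · refine SimpleGraph.degree_eq_three_of_adj_iff (coronaGraph_adj_zero hk i) ?_ ?_ ?_
    · simp
    · simp
    · obtain ⟨i, hi⟩ := i
      dsimp only
      split_ifs <;> simp <;> omega
  · exact SimpleGraph.degree_eq_two_of_adj_iff (coronaGraph_adj_one i) (by simp)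
  · exact SimpleGraph.degree_eq_one_of_adj_iff (coronaGraph_adj_two i)

end Corona

section Small

instance (n : ℕ) : DecidableRel (cycleG n).Adj := fun p q =>
  inferInstanceAs (Decidable (p ≠ q ∧ (_ ∨ _)))

instance : DecidableRel gpRel := fun p q => by
  unfold gpRel
  infer_instance

instance : DecidableRel GP16.Adj := fun p q =>
  inferInstanceAs (Decidable (p ≠ q ∧ (_ ∨ _)))

theorem totalDominationNumber_cycleG_three : totalDominationNumber (cycleG 3) = 2 :=
  totalDominationNumber_eq _ _ {0, 1} rfl (by decide) (by decide)

theorem totalDominationNumber_cycleG_six : totalDominationNumber (cycleG 6) = 4 :=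
  totalDominationNumber_eq _ _ {0, 1, 3, 4} rfl (by decide) (by decide)

theorem GP16_mem_of_adj : ∀ v u, GP16.Adj v u →
    u = (v.1 + 1, v.2) ∨ u = (v.1, v.2 + ![1, 3] v.1) ∨ u = (v.1, v.2 - ![1, 3] v.1) := by
  decide

/-- Every transversal of the eight lines of the Möbius–Kantor configuration has at least four
points. -/
theorem four_le_of_mobiusKantor : ∀ a₀ a₁ a₂ a₃ b₀ b₁ b₂ b₃ : Bool,
    (b₀ || a₀ || a₃) → (b₁ || a₁ || a₀) → (b₂ || a₂ || a₁) → (b₃ || a₃ || a₂) →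
    (a₀ || b₂ || b₃) → (a₁ || b₃ || b₀) → (a₂ || b₀ || b₁) → (a₃ || b₁ || b₂) →
    4 ≤ a₀.toNat + a₁.toNat + a₂.toNat + a₃.toNat +
      (b₀.toNat + b₁.toNat + b₂.toNat + b₃.toNat) := by
  decide

theorem totalDominationNumber_GP16 : totalDominationNumber GP16 = 8 := by
  refine totalDominationNumber_eq _ _ (Finset.univ ×ˢ {0, 1, 4, 5}) rfl (by decide) fun T hT => ?_
  set x : Fin 2 → Fin 8 → Bool := fun i j => decide ((i, j) ∈ T) with hx
  have h : ∀ i j, x (i + 1) j || x i (j + ![1, 3] i) || x i (j - ![1, 3] i) := fun i j => by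
    obtain ⟨u, hu, hadj⟩ := hT (i, j)
    rcases GP16_mem_of_adj _ u hadj with rfl | rfl | rfl <;> simp [hx, hu]
  have hcard : T.card = ∑ i, ∑ j, (x i j).toNat := by
    rw [← Fintype.sum_prod_type' (f := fun i j => (x i j).toNat), ← Finset.filter_univ_mem T,
      Finset.card_filter]
    exact Finset.sum_congr rfl fun p _ => by by_cases hp : p ∈ T <;> simp [hx, hp]
  have h₁ := four_le_of_mobiusKantor (x 0 1) (x 0 3) (x 0 5) (x 0 7)
    (x 1 0) (x 1 2) (x 1 4) (x 1 6)
    (h 0 0) (h 0 2) (h 0 4) (h 0 6) (h 1 1) (h 1 3) (h 1 5) (h 1 7)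
  have h₂ := four_le_of_mobiusKantor (x 0 2) (x 0 4) (x 0 6) (x 0 0)
    (x 1 1) (x 1 3) (x 1 5) (x 1 7)
    (h 0 1) (h 0 3) (h 0 5) (h 0 7) (h 1 2) (h 1 4) (h 1 6) (h 1 0)
  simp only [hcard, Fin.sum_univ_two, Fin.sum_univ_eight]
  omega

end Small

/-- If `G` is isomorphic to one of `C_k ∘ P_2` (`k ≥ 3`), `F_k` (`k ≥ 0`, where `F_0 = C_3`),
`L_k` (`k ≥ 0`, where `L_0 = C_6`), `G_k` (`k ≥ 1`), `H_k` (`k ≥ 2`), or `GP_16`, then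
`m = Δ(n − γt)`. -/
theorem size_eq_Delta_mul_order_sub_totalDominationNumber_of_extremal
    {V : Type*} [Fintype V] [DecidableEq V] (G : SimpleGraph V) [DecidableRel G.Adj]
    (Δ : ℕ) (hΔ2 : G.maxDegree = 2 → Δ = 3) (hΔ3 : 3 ≤ G.maxDegree → Δ = G.maxDegree)
    (hext : (∃ k, 3 ≤ k ∧ Nonempty (G ≃g coronaGraph k)) ∨
       Nonempty (G ≃g cycleG 3) ∨
       (∃ k, 1 ≤ k ∧ Nonempty (G ≃g FkGraph k)) ∨
       Nonempty (G ≃g cycleG 6) ∨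
       (∃ k, 1 ≤ k ∧ Nonempty (G ≃g LkGraph k)) ∨
       (∃ k, 1 ≤ k ∧ Nonempty (G ≃g GkGraph k)) ∨
       (∃ k, 2 ≤ k ∧ Nonempty (G ≃g HkGraph k)) ∨
       Nonempty (G ≃g GP16)) :
    G.edgeFinset.card = Δ * (Fintype.card V - totalDominationNumber G) := by
  classical
  rcases hext with ⟨k, hk, ⟨e⟩⟩ | ⟨⟨e⟩⟩ | ⟨k, hk, ⟨e⟩⟩ | ⟨⟨e⟩⟩ | ⟨k, hk, ⟨e⟩⟩ | ⟨k, hk, ⟨e⟩⟩ |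
    ⟨k, hk, ⟨e⟩⟩ | ⟨⟨e⟩⟩
  · refine card_edgeFinset_eq_of_iso e hΔ2 hΔ3 (fun w => ?_) ⟨(0, ⟨0, by omega⟩), ?_⟩ ?_
    · simp [coronaGraph_degree hk]
    · simp [coronaGraph_degree hk]
    · simp [coronaGraph_degree hk, totalDominationNumber_coronaGraph hk, Fintype.sum_prod_type,
        Fin.sum_univ_succ]
      omega
  · refine card_edgeFinset_eq_of_iso e hΔ2 hΔ3 (by decide) (by decide) ?_
    rw [totalDominationNumber_cycleG_three]
    decide
  · refine card_edgeFinset_eq_of_iso e hΔ2 hΔ3 (fun w => ?_) ⟨Sum.inr 0, ?_⟩ ?_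
    · obtain p | j := w
      · exact (FkGraph_degree_inl hk p).le
      · exact (FkGraph_degree_inr hk j).le.trans (by norm_num)
    · exact (FkGraph_degree_inr hk 0).ge
    · simp [FkGraph_degree_inl hk, FkGraph_degree_inr hk, totalDominationNumber_FkGraph hk]
      omega
  · refine card_edgeFinset_eq_of_iso e hΔ2 hΔ3 (by decide) (by decide) ?_
    rw [totalDominationNumber_cycleG_six]
    decide
  · refine card_edgeFinset_eq_of_iso e hΔ2 hΔ3 (fun w => ?_) ⟨Sum.inr 0, ?_⟩ ?_
    · obtain p | j := w
      · exact (LkGraph_degree_inl p).le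
      · exact (LkGraph_degree_inr hk j).le.trans (by norm_num)
    · exact (LkGraph_degree_inr hk 0).ge
    · simp [LkGraph_degree_inl, LkGraph_degree_inr hk, totalDominationNumber_LkGraph hk]
      omega
  · refine card_edgeFinset_eq_of_iso e hΔ2 hΔ3 (fun w => (GkGraph_degree hk w).le)
      ⟨(0, ⟨0, hk⟩), by simp [GkGraph_degree hk]⟩ ?_
    simp [GkGraph_degree hk, totalDominationNumber_GkGraph hk]
    omega
  · refine card_edgeFinset_eq_of_iso e hΔ2 hΔ3 (fun w => (HkGraph_degree hk w).le)
      ⟨(0, ⟨0, by omega⟩), by simp [HkGraph_degree hk]⟩ ?_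
    simp [HkGraph_degree hk, totalDominationNumber_HkGraph hk]
    omega
  · refine card_edgeFinset_eq_of_iso e hΔ2 hΔ3 (by decide) (by decide) ?_
    rw [totalDominationNumber_GP16]
    decide
end

section
/- Let k ≥ 3 and let G = C_k ∘ P_2 be the 2-corona of the cycle C_k. If v is a vertex of G of degree 1, then γt(G − v) = γt(G) − 1. -/
open SimpleGraph

theorem totalDominationNumber_le_card {V : Type*} [Fintype V] {G : SimpleGraph V} {S : Finset V}
    (hS : ∀ v, ∃ u ∈ S, G.Adj v u) : totalDominationNumber G ≤ S.card :=
  Nat.sInf_le ⟨S, rfl, hS⟩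

theorem exists_card_eq_totalDominationNumber {V : Type*} [Fintype V] {G : SimpleGraph V}
    {S : Finset V} (hS : ∀ v, ∃ u ∈ S, G.Adj v u) :
    ∃ T : Finset V, T.card = totalDominationNumber G ∧ ∀ v, ∃ u ∈ T, G.Adj v u :=
  Nat.sInf_mem (s := {n | ∃ S : Finset V, S.card = n ∧ ∀ v : V, ∃ u ∈ S, G.Adj v u})
    ⟨_, S, rfl, hS⟩

/-- Adding a neighbor of `v` turns a total dominating set of `G - v` into one of `G`. -/
theorem totalDominationNumber_le_deleteVert_add_one {V : Type*} [Fintype V] {G : SimpleGraph V}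
    {v w : V} [Fintype {w : V // w ≠ v}] (hvw : G.Adj v w) {S : Finset {w : V // w ≠ v}}
    (hS : ∀ u, ∃ x ∈ S, (deleteVert G v).Adj u x) :
    totalDominationNumber G ≤ totalDominationNumber (deleteVert G v) + 1 := by
  classical
  obtain ⟨T, hT, hdom⟩ := exists_card_eq_totalDominationNumber hS
  rw [← hT, ← Finset.card_map (Function.Embedding.subtype _)]
  refine (totalDominationNumber_le_card fun u => ?_).trans (Finset.card_insert_le w _)
  by_cases hu : u = v
  · exact ⟨w, Finset.mem_insert_self _ _, hu ▸ hvw⟩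
  · obtain ⟨x, hx, hux⟩ := hdom ⟨u, hu⟩
    exact ⟨x, Finset.mem_insert_of_mem (Finset.mem_map_of_mem _ hx), hux⟩

section Corona

variable {k : ℕ}

theorem coronaGraph_adj_zero_one (i : Fin k) : (coronaGraph k).Adj (0, i) (1, i) := by
  simp [coronaGraph, coronaRel]

theorem coronaGraph_adj_one_two (i : Fin k) : (coronaGraph k).Adj (1, i) (2, i) := by
  simp [coronaGraph, coronaRel]

theorem exists_coronaGraph_adj_zero_zero (hk : 2 ≤ k) (i : Fin k) :
    ∃ j, (coronaGraph k).Adj (0, i) (0, j) := by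
  refine ⟨⟨(i + 1) % k, Nat.mod_lt _ (by omega)⟩, ?_⟩
  refine (SimpleGraph.fromRel_adj _ _ _).2 ⟨fun h => ?_, .inl (.inl ⟨rfl, rfl, rfl⟩)⟩
  have h' : (i : ℕ) = (i + 1) % k := congrArg (fun p : Fin 3 × Fin k => (p.2 : ℕ)) h
  rcases Nat.lt_or_ge (i + 1) k with hi | hi
  · rw [Nat.mod_eq_of_lt hi] at h'
    omega
  · rw [show (i : ℕ) + 1 = k by omega, Nat.mod_self] at h'
    omega

theorem eq_of_coronaGraph_adj_two {i : Fin k} {u : Fin 3 × Fin k}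
    (h : (coronaGraph k).Adj (2, i) u) : u = (1, i) := by
  simp_all [coronaGraph, coronaRel, Prod.ext_iff]

theorem ne_one_and_snd_eq_of_coronaGraph_adj_one {i : Fin k} {u : Fin 3 × Fin k}
    (h : (coronaGraph k).Adj (1, i) u) : u.1 ≠ 1 ∧ u.2 = i := by
  obtain ⟨a, j⟩ := u
  fin_cases a <;> simp_all [coronaGraph, coronaRel]

theorem two_mul_le_card_of_coronaGraph_dominating {S : Finset (Fin 3 × Fin k)}
    (hS : ∀ v, ∃ u ∈ S, (coronaGraph k).Adj v u) : 2 * k ≤ S.card := by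
  have hmid (i : Fin k) : (1, i) ∈ S := by
    obtain ⟨u, hu, h⟩ := hS (2, i)
    exact eq_of_coronaGraph_adj_two h ▸ hu
  choose g hgS hg using fun i => hS (1, i)
  let f : Fin k ⊕ Fin k → Fin 3 × Fin k := Sum.elim (fun i => (1, i)) g
  have hf : Function.Injective f := by
    refine Function.Injective.sumElim (Prod.mk_right_injective _) (fun i j hij => ?_)
      fun i j hij => ?_
    · rw [← (ne_one_and_snd_eq_of_coronaGraph_adj_one (hg i)).2, hij,
        (ne_one_and_snd_eq_of_coronaGraph_adj_one (hg j)).2]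
    · exact (ne_one_and_snd_eq_of_coronaGraph_adj_one (hg j)).1 (congrArg Prod.fst hij).symm
  have hfS : ∀ x ∈ Finset.univ, f x ∈ S := by
    rintro (i | i) -
    exacts [hmid i, hgS i]
  simpa [two_mul] using Finset.card_le_card_of_injOn f hfS hf.injOn

theorem fst_eq_two_of_ncard_neighborSet_eq_one (hk : 2 ≤ k) {v : Fin 3 × Fin k}
    (hv : ((coronaGraph k).neighborSet v).ncard = 1) : v.1 = 2 := by
  obtain ⟨u, hu⟩ := Set.ncard_eq_one.1 hv
  have huniq {x y} (hx : (coronaGraph k).Adj v x) (hy : (coronaGraph k).Adj v y) : x = y :=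
    ((Set.ext_iff.1 hu x).1 hx).trans ((Set.ext_iff.1 hu y).1 hy).symm
  obtain ⟨a, i⟩ := v
  fin_cases a
  · obtain ⟨j, hj⟩ := exists_coronaGraph_adj_zero_zero hk i
    simpa using huniq hj (coronaGraph_adj_zero_one i)
  · simpa using huniq (coronaGraph_adj_zero_one i).symm (coronaGraph_adj_one_two i)
  · rfl

theorem exists_dominating_deleteVert_coronaGraph (hk : 2 ≤ k) (i : Fin k) :
    ∃ S : Finset {w : Fin 3 × Fin k // w ≠ (2, i)}, S.card ≤ 2 * k - 1 ∧
      ∀ v, ∃ u ∈ S, (deleteVert (coronaGraph k) (2, i)).Adj v u := by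
  let T : Finset (Fin 3 × Fin k) := (({0, 1} : Finset (Fin 3)) ×ˢ Finset.univ).erase (1, i)
  refine ⟨T.subtype _, ?_, ?_⟩
  · rw [Finset.card_subtype]
    refine (Finset.card_filter_le _ _).trans_eq ?_
    rw [Finset.card_erase_of_mem (by simp), Finset.card_product]
    simp
  · rintro ⟨⟨a, j⟩, hv⟩
    suffices ∃ u ∈ T, u ≠ (2, i) ∧ (coronaGraph k).Adj (a, j) u by
      obtain ⟨u, huT, hu, h⟩ := this
      exact ⟨⟨u, hu⟩, Finset.mem_subtype.2 huT, h⟩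
    fin_cases a
    · obtain ⟨l, hl⟩ := exists_coronaGraph_adj_zero_zero hk j
      exact ⟨(0, l), by simp [T], by simp, hl⟩
    · exact ⟨(0, j), by simp [T], by simp, (coronaGraph_adj_zero_one j).symm⟩
    · have hj : j ≠ i := by simpa using hv
      exact ⟨(1, j), by simp [T, hj], by simp, (coronaGraph_adj_one_two j).symm⟩

end Corona

/-- For `k ≥ 3` and `G = C_k ∘ P_2`, deleting a vertex of degree 1 decreases the total
domination number by exactly 1. -/
theorem totalDominationNumber_corona_deleteVert_of_degree_one (k : ℕ) (hk : 3 ≤ k)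
    (v : Fin 3 × Fin k) (hv : ((coronaGraph k).neighborSet v).ncard = 1) :
    totalDominationNumber (deleteVert (coronaGraph k) v) =
      totalDominationNumber (coronaGraph k) - 1 := by
  have hk' : 2 ≤ k := by omega
  obtain ⟨a, i⟩ := v
  obtain rfl : a = 2 := fst_eq_two_of_ncard_neighborSet_eq_one hk' hv
  obtain ⟨S, hcard, hS⟩ := exists_dominating_deleteVert_coronaGraph hk' i
  have hle := totalDominationNumber_le_card hS
  have hadd := totalDominationNumber_le_deleteVert_add_one (coronaGraph_adj_one_two i).symm hS
  have hdom (v : Fin 3 × Fin k) : ∃ u ∈ Finset.univ, (coronaGraph k).Adj v u := by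
    obtain ⟨a, j⟩ := v
    fin_cases a
    · exact ⟨_, Finset.mem_univ _, coronaGraph_adj_zero_one j⟩
    · exact ⟨_, Finset.mem_univ _, coronaGraph_adj_one_two j⟩
    · exact ⟨_, Finset.mem_univ _, (coronaGraph_adj_one_two j).symm⟩
  obtain ⟨T, hT, hTdom⟩ := exists_card_eq_totalDominationNumber hdom
  have hge := two_mul_le_card_of_coronaGraph_dominating hTdom
  omega
end

section
/- For every integer k ≥ 1, let F_k be the graph of order n = 4k + 3 with special 2-path a_1 v_1 v_2 v_3 c_1, and let w ∈ {v_1, v_2, v_3}. Then γt(F_k − w) = (n − 1)/2 = 2k + 1. -/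
open SimpleGraph

/-- Total dominating sets of `G - w` seen as sets of vertices of `G` avoiding `w`. -/
theorem totalDominationNumber_deleteVert {V : Type*} [Fintype V] [DecidableEq V]
    (G : SimpleGraph V) (w : V) :
    totalDominationNumber (deleteVert G w) =
      sInf {n | ∃ T : Finset V, T.card = n ∧ w ∉ T ∧ ∀ v, v ≠ w → ∃ u ∈ T, G.Adj v u} := by
  unfold totalDominationNumber
  congr 1
  ext n
  constructor
  · rintro ⟨S, hS, h⟩
    refine ⟨S.map (Function.Embedding.subtype _), by simpa using hS, by simp, fun v hv => ?_⟩
    obtain ⟨u, hu, huv⟩ := h ⟨v, hv⟩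
    exact ⟨u, Finset.mem_map_of_mem _ hu, huv⟩
  · rintro ⟨T, hT, hw, h⟩
    refine ⟨T.subtype (· ≠ w), ?_, fun v => ?_⟩
    · rw [← hT, Finset.card_subtype, Finset.filter_true_of_mem]
      exact fun x hx hxw => hw (hxw ▸ hx)
    · obtain ⟨u, hu, huv⟩ := h v v.2
      exact ⟨⟨u, fun huw => hw (huw ▸ hu)⟩, by simpa using hu, huv⟩

/-- If every zero of a sequence is followed by a term at least `2`, then its partial sums grow
at least linearly. -/
theorem add_le_sum_range_of_zero_imp_two_le {z : ℕ → ℕ} {c n : ℕ}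
    (hz : ∀ i < n, z i = 0 → 2 ≤ z (i + 1)) (hc : c ≤ z 0 + 1) (hc' : 0 < z 0 → c ≤ z 0) :
    c + n ≤ ∑ i ∈ Finset.range (n + 1), z i + 1 ∧
      (0 < z n → c + n ≤ ∑ i ∈ Finset.range (n + 1), z i) := by
  induction n with
  | zero => simpa using ⟨hc, hc'⟩
  | succ n ih =>
    have h := ih fun i hi => hz i (by omega)
    have hn := hz n (by omega)
    rw [Finset.sum_range_succ]
    omega

namespace FkGraph

variable {k : ℕ}

theorem eq_of_adj_a {i : Fin k} {u : FkVert k} (h : (FkGraph k).Adj (Sum.inl (0, i)) u) :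
    u = Sum.inl (1, i) ∨ u = Sum.inl (3, i) ∨
      (∃ i' : Fin k, (i' : ℕ) + 1 = i ∧ u = Sum.inl (1, i')) ∨ ((i : ℕ) = 0 ∧ u = Sum.inr 0) := by
  rcases u with ⟨t, l⟩ | l
  · fin_cases t <;> simp_all [FkGraph, fkRel, gkBase]
    grind
  · fin_cases l <;> simp_all [FkGraph, fkRel]

theorem eq_of_adj_c {i : Fin k} {u : FkVert k} (h : (FkGraph k).Adj (Sum.inl (2, i)) u) :
    u = Sum.inl (1, i) ∨ u = Sum.inl (3, i) ∨
      (∃ i' : Fin k, (i' : ℕ) + 1 = i ∧ u = Sum.inl (3, i')) ∨ ((i : ℕ) = 0 ∧ u = Sum.inr 2) := by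
  rcases u with ⟨t, l⟩ | l
  · fin_cases t <;> simp_all [FkGraph, fkRel, gkBase]
    grind
  · fin_cases l <;> simp_all [FkGraph, fkRel]

theorem eq_of_adj_b {i : Fin k} {u : FkVert k} (h : (FkGraph k).Adj (Sum.inl (1, i)) u) :
    u = Sum.inl (0, i) ∨ u = Sum.inl (2, i) ∨
      (∃ i' : Fin k, (i' : ℕ) = i + 1 ∧ u = Sum.inl (0, i')) ∨
      ((i : ℕ) + 1 = k ∧ u = Sum.inl (3, i)) := by
  rcases u with ⟨t, l⟩ | l
  · fin_cases t <;> simp_all [FkGraph, fkRel, gkBase] <;> grind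
  · fin_cases l <;> simp_all [FkGraph, fkRel]

theorem eq_of_adj_d {i : Fin k} {u : FkVert k} (h : (FkGraph k).Adj (Sum.inl (3, i)) u) :
    u = Sum.inl (0, i) ∨ u = Sum.inl (2, i) ∨
      (∃ i' : Fin k, (i' : ℕ) = i + 1 ∧ u = Sum.inl (2, i')) ∨
      ((i : ℕ) + 1 = k ∧ u = Sum.inl (1, i)) := by
  rcases u with ⟨t, l⟩ | l
  · fin_cases t <;> simp_all [FkGraph, fkRel, gkBase] <;> grind
  · fin_cases l <;> simp_all [FkGraph, fkRel]

theorem eq_of_adj_v₁ {u : FkVert k} (h : (FkGraph k).Adj (Sum.inr 0) u) :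
    u = Sum.inr 1 ∨ ∃ i : Fin k, (i : ℕ) = 0 ∧ u = Sum.inl (0, i) := by
  rcases u with ⟨t, l⟩ | l
  · fin_cases t <;> simp_all [FkGraph, fkRel]
  · fin_cases l <;> simp_all [FkGraph, fkRel]

theorem eq_of_adj_v₂ {u : FkVert k} (h : (FkGraph k).Adj (Sum.inr 1) u) :
    u = Sum.inr 0 ∨ u = Sum.inr 2 := by
  rcases u with ⟨t, l⟩ | l
  · fin_cases t <;> simp_all [FkGraph, fkRel]
  · fin_cases l <;> simp_all [FkGraph, fkRel]

theorem eq_of_adj_v₃ {u : FkVert k} (h : (FkGraph k).Adj (Sum.inr 2) u) :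
    u = Sum.inr 1 ∨ ∃ i : Fin k, (i : ℕ) = 0 ∧ u = Sum.inl (2, i) := by
  rcases u with ⟨t, l⟩ | l
  · fin_cases t <;> simp_all [FkGraph, fkRel]
  · fin_cases l <;> simp_all [FkGraph, fkRel]

/-- The number of vertices of `T` among `(t, i)` and `(t', i)`; zero for `i` out of range. -/
def pairCount (T : Finset (FkVert k)) (t t' : Fin 4) (i : ℕ) : ℕ :=
  if h : i < k then
    (if Sum.inl (t, ⟨i, h⟩) ∈ T then 1 else 0) + (if Sum.inl (t', ⟨i, h⟩) ∈ T then 1 else 0)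
  else 0

/-- The numbers of vertices of `T` in the pairs `{a_1, c_1}, …, {a_k, c_k}, {b_k, d_k}, …,
{b_1, d_1}, {v_1, v_3}`, in this order. -/
def chainCount (T : Finset (FkVert k)) (m : ℕ) : ℕ :=
  if m < k then pairCount T 0 2 m
  else if m < 2 * k then pairCount T 1 3 (2 * k - 1 - m)
  else (if Sum.inr 0 ∈ T then 1 else 0) + (if Sum.inr 2 ∈ T then 1 else 0)

theorem sum_chainCount_le_card (T : Finset (FkVert k)) :
    ∑ m ∈ Finset.range (2 * k + 1), chainCount T m ≤ T.card := by
  have hac : ∑ m ∈ Finset.range k, chainCount T m = ∑ i ∈ Finset.range k, pairCount T 0 2 i :=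
    Finset.sum_congr rfl fun m hm => by simp_all [chainCount]
  have hbd : ∑ m ∈ Finset.range k, chainCount T (k + m) =
      ∑ i ∈ Finset.range k, pairCount T 1 3 i := by
    rw [← Finset.sum_range_reflect]
    refine Finset.sum_congr rfl fun m hm => ?_
    have hm := Finset.mem_range.1 hm
    rw [chainCount, if_neg (by omega), if_pos (by omega)]
    congr 1
    omega
  have hpair (t t' : Fin 4) : ∑ i ∈ Finset.range k, pairCount T t t' i =
      ∑ i : Fin k, ((if Sum.inl (t, i) ∈ T then 1 else 0) +
        (if Sum.inl (t', i) ∈ T then 1 else 0)) := by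
    rw [← Fin.sum_univ_eq_sum_range]
    exact Finset.sum_congr rfl fun i _ => by simp [pairCount]
  have hcard : T.card = ∑ v : FkVert k, if v ∈ T then 1 else 0 := by simp
  rw [Finset.sum_range_succ, two_mul, Finset.sum_range_add, hac, hbd, hpair, hpair, hcard,
    Fintype.sum_sum_type, Fintype.sum_prod_type, Fin.sum_univ_four, Fin.sum_univ_three]
  simp only [Finset.sum_add_distrib, chainCount]
  rw [if_neg (by omega), if_neg (by omega)]
  omega

theorem two_le_chainCount_succ {T : Finset (FkVert k)}
    (hT : ∀ p : Fin 4 × Fin k, ∃ u ∈ T, (FkGraph k).Adj (Sum.inl p) u) {m : ℕ} (hm : m < 2 * k)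
    (h0 : chainCount T m = 0) : 2 ≤ chainCount T (m + 1) := by
  by_cases hmk : m < k
  · obtain ⟨u, hu, hub⟩ := hT (1, ⟨m, hmk⟩)
    obtain ⟨u', hu', hud⟩ := hT (3, ⟨m, hmk⟩)
    replace hub := eq_of_adj_b hub
    replace hud := eq_of_adj_d hud
    by_cases hmk' : m + 1 < k
    · simp [chainCount, pairCount, hmk, hmk'] at h0 ⊢
      grind
    · have h2 : 2 * k - 1 - (m + 1) = m := by omega
      have h3 : m + 1 < 2 * k := by omega
      simp [chainCount, pairCount, hmk, hmk', h2, h3] at h0 ⊢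
      grind
  · obtain ⟨i, hi⟩ : ∃ i, i = 2 * k - 1 - m := ⟨_, rfl⟩
    have hik : i < k := by omega
    obtain ⟨u, hu, hua⟩ := hT (0, ⟨i, hik⟩)
    obtain ⟨u', hu', huc⟩ := hT (2, ⟨i, hik⟩)
    replace hua := eq_of_adj_a hua
    replace huc := eq_of_adj_c huc
    have h1 : ¬ m + 1 < k := by omega
    simp only [chainCount, pairCount, hmk, hm, h1, ← hi, hik, if_true, if_false, dif_pos] at h0 ⊢
    by_cases hm' : m + 1 < 2 * k
    · have h2 : 2 * k - 1 - (m + 1) = i - 1 := by omega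
      have h3 : i - 1 < k := by omega
      simp [hm', h2, h3] at h0 ⊢
      grind
    · simp [hm'] at h0 ⊢
      grind

theorem two_mul_add_one_le_card (hk : 1 ≤ k) (j : Fin 3) {T : Finset (FkVert k)}
    (hj : Sum.inr j ∉ T)
    (hT : ∀ v, v ≠ Sum.inr j → ∃ u ∈ T, (FkGraph k).Adj v u) : 2 * k + 1 ≤ T.card := by
  have hchain (m : ℕ) (hm : m < 2 * k) := two_le_chainCount_succ (fun p => hT _ (by simp)) hm
  refine le_trans ?_ (sum_chainCount_le_card T)
  by_cases hj1 : j = 1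
  · subst hj1
    obtain ⟨u, hu, hu₁⟩ := hT (Sum.inr 0) (by simp)
    obtain ⟨u', hu', hu₃⟩ := hT (Sum.inr 2) (by simp)
    replace hu₁ := eq_of_adj_v₁ hu₁
    replace hu₃ := eq_of_adj_v₃ hu₃
    have h0 : chainCount T 0 = 2 := by
      simp [chainCount, pairCount, show 0 < k by omega]
      grind
    have := (add_le_sum_range_of_zero_imp_two_le (c := 2) hchain (by omega) (by omega)).1
    omega
  · obtain ⟨u, hu, hu₂⟩ := hT (Sum.inr 1) (by simpa using Ne.symm hj1)
    replace hu₂ := eq_of_adj_v₂ hu₂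
    have hlast : 0 < chainCount T (2 * k) := by
      have h : ¬ 2 * k < k := by omega
      simp [chainCount, h]
      grind
    have := (add_le_sum_range_of_zero_imp_two_le (c := 1) hchain (by omega) (by omega)).2 hlast
    omega

theorem exists_card_eq_two_mul_add_one (hk : 1 ≤ k) (j : Fin 3) :
    ∃ T : Finset (FkVert k), T.card = 2 * k + 1 ∧ Sum.inr j ∉ T ∧
      ∀ v, v ≠ Sum.inr j → ∃ u ∈ T, (FkGraph k).Adj v u := by
  have hk0 : 0 < k := hk
  fin_cases j
  · refine ⟨Finset.disjSum ({2, 3} ×ˢ Finset.univ) {2}, by simp, by simp, ?_⟩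
    rintro (⟨t, i⟩ | l) hv
    · refine ⟨Sum.inl (![3, 2, 3, 2] t, i), ?_, ?_⟩ <;> fin_cases t <;>
        simp [FkGraph, fkRel, gkBase]
    · refine ⟨![Sum.inr 2, Sum.inr 2, Sum.inl (2, ⟨0, hk0⟩)] l, ?_, ?_⟩ <;> fin_cases l <;>
        simp_all [FkGraph, fkRel]
  · refine ⟨Finset.disjSum (insert (0, ⟨0, hk0⟩) ({2, 3} ×ˢ Finset.univ)) ∅, by simp, by simp, ?_⟩
    rintro (⟨t, i⟩ | l) hv
    · refine ⟨Sum.inl (![3, 2, 3, 2] t, i), ?_, ?_⟩ <;> fin_cases t <;>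
        simp [FkGraph, fkRel, gkBase]
    · refine ⟨Sum.inl (![0, 0, 2] l, ⟨0, hk0⟩), ?_, ?_⟩ <;> fin_cases l <;>
        simp_all [FkGraph, fkRel]
  · refine ⟨Finset.disjSum ({0, 1} ×ˢ Finset.univ) {0}, by simp, by simp, ?_⟩
    rintro (⟨t, i⟩ | l) hv
    · refine ⟨Sum.inl (![1, 0, 1, 0] t, i), ?_, ?_⟩ <;> fin_cases t <;>
        simp [FkGraph, fkRel, gkBase]
    · refine ⟨![Sum.inl (0, ⟨0, hk0⟩), Sum.inr 0, Sum.inr 0] l, ?_, ?_⟩ <;> fin_cases l <;>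
        simp_all [FkGraph, fkRel]

end FkGraph

/-- For `k ≥ 1`, deleting any vertex `w ∈ {v_1, v_2, v_3}` of the special 2-path
`a_1 v_1 v_2 v_3 c_1` of `F_k` gives `γt(F_k − w) = (n − 1)/2 = 2k + 1`. -/
theorem totalDominationNumber_Fk_deleteVert (k : ℕ) (hk : 1 ≤ k) (j : Fin 3) :
    totalDominationNumber (deleteVert (FkGraph k) (Sum.inr j)) = 2 * k + 1 := by
  rw [totalDominationNumber_deleteVert]
  apply le_antisymm
  · exact Nat.sInf_le (FkGraph.exists_card_eq_two_mul_add_one hk j)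
  · refine le_csInf ⟨_, FkGraph.exists_card_eq_two_mul_add_one hk j⟩ ?_
    rintro n ⟨T, rfl, hj, hT⟩
    exact FkGraph.two_mul_add_one_le_card hk j hj hT
end

section
/- For every integer k ≥ 1, let F_k be the graph of order n = 4k + 3 with special 2-path a_1 v_1 v_2 v_3 c_1, and let w ∈ {v_1, v_2, v_3}. Then γta(F_k; w) = (n − 1)/2 = 2k + 1. -/
open SimpleGraph

theorem add_pred_le_sum_succ {x : ℕ → ℕ} (m : ℕ)
    (h : ∀ j < m, 1 ≤ x (j + 1) ∨ 2 ≤ x j) :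
    m + (x m - 1) ≤ ∑ i ∈ Finset.range m, x (i + 1) + (x 0 - 1) := by
  induction m with
  | zero => simp
  | succ m ih =>
    have := ih fun j hj => h j (by omega)
    have := h m (by omega)
    rw [Finset.sum_range_succ]
    omega

theorem add_pred_le_sum {x : ℕ → ℕ} (m : ℕ)
    (h : ∀ j < m, 1 ≤ x j ∨ 2 ≤ x (j + 1)) :
    m + (x 0 - 1) ≤ ∑ i ∈ Finset.range m, x i + (x m - 1) := by
  induction m with
  | zero => simp
  | succ m ih =>
    have := ih fun j hj => h j (by omega)
    have := h m (by omega)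
    rw [Finset.sum_range_succ]
    omega

section neighbors

variable {k : ℕ} {i : Fin k} {u : FkVert k}

theorem FkGraph_adj_a (h : (FkGraph k).Adj (Sum.inl (0, i)) u) :
    u = Sum.inl (1, i) ∨ u = Sum.inl (3, i) ∨
      (∃ i' : Fin k, (i' : ℕ) + 1 = i ∧ u = Sum.inl (1, i')) ∨
      ((i : ℕ) = 0 ∧ u = Sum.inr 0) := by
  rcases u with ⟨t, i'⟩ | t <;> fin_cases t <;>
    simp [FkGraph, fkRel, gkBase, Fin.ext_iff] at h ⊢ <;> grind

theorem FkGraph_adj_b (h : (FkGraph k).Adj (Sum.inl (1, i)) u) :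
    u = Sum.inl (0, i) ∨ u = Sum.inl (2, i) ∨
      (∃ i' : Fin k, (i' : ℕ) = i + 1 ∧ u = Sum.inl (0, i')) ∨
      ((i : ℕ) + 1 = k ∧ u = Sum.inl (3, i)) := by
  rcases u with ⟨t, i'⟩ | t <;> fin_cases t <;>
    simp [FkGraph, fkRel, gkBase, Fin.ext_iff] at h ⊢ <;> grind

theorem FkGraph_adj_c (h : (FkGraph k).Adj (Sum.inl (2, i)) u) :
    u = Sum.inl (1, i) ∨ u = Sum.inl (3, i) ∨
      (∃ i' : Fin k, (i' : ℕ) + 1 = i ∧ u = Sum.inl (3, i')) ∨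
      ((i : ℕ) = 0 ∧ u = Sum.inr 2) := by
  rcases u with ⟨t, i'⟩ | t <;> fin_cases t <;>
    simp [FkGraph, fkRel, gkBase, Fin.ext_iff] at h ⊢ <;> grind

theorem FkGraph_adj_d (h : (FkGraph k).Adj (Sum.inl (3, i)) u) :
    u = Sum.inl (0, i) ∨ u = Sum.inl (2, i) ∨
      (∃ i' : Fin k, (i' : ℕ) = i + 1 ∧ u = Sum.inl (2, i')) ∨
      ((i : ℕ) + 1 = k ∧ u = Sum.inl (1, i)) := by
  rcases u with ⟨t, i'⟩ | t <;> fin_cases t <;>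
    simp [FkGraph, fkRel, gkBase, Fin.ext_iff] at h ⊢ <;> grind

end neighbors

open Classical in
theorem two_mul_add_one_le_card_of_dominates {k : ℕ} (S : Finset (FkVert k)) (j : Fin 3)
    (hj : Sum.inr j ∈ S)
    (hS : ∀ p : Fin 4 × Fin k, ∃ u ∈ S, (FkGraph k).Adj (Sum.inl p) u) :
    2 * k + 1 ≤ S.card := by
  set f : Fin 4 → ℕ → ℕ := fun t i =>
    if ∃ h : i < k, Sum.inl (t, ⟨i, h⟩) ∈ S then 1 else 0 with hf
  set g : Fin 3 → ℕ := fun t => if Sum.inr t ∈ S then 1 else 0 with hg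
  have hfS : ∀ {t : Fin 4} {i : Fin k}, Sum.inl (t, i) ∈ S → f t i = 1 := by
    intro t i h
    simp [hf, h]
  have hgS : ∀ {t : Fin 3}, Sum.inr t ∈ S → g t = 1 := by
    intro t h
    simp [hg, h]
  have hcard : S.card = ∑ i ∈ Finset.range k, (f 0 i + f 2 i) +
      ∑ i ∈ Finset.range k, (f 1 i + f 3 i) + (g 0 + g 1 + g 2) := by
    have h1 : S.card = ∑ v : FkVert k, if v ∈ S then 1 else 0 := by simp
    rw [h1, Fintype.sum_sum_type, Fin.sum_univ_three, Fintype.sum_prod_type]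
    have h2 : ∀ t : Fin 4, (∑ i : Fin k, if Sum.inl (t, i) ∈ S then 1 else 0) =
        ∑ i ∈ Finset.range k, f t i := by
      intro t
      rw [Finset.sum_range]
      simp [hf]
    simp only [h2, Fin.sum_univ_four, Finset.sum_add_distrib, hg]
    omega
  have hBD := add_pred_le_sum_succ k
    (x := fun i => if i = 0 then g 0 + g 2 else f 1 (i - 1) + f 3 (i - 1)) (by
      intro i hi
      obtain ⟨u, huS, hu⟩ := hS (0, ⟨i, hi⟩)
      obtain ⟨v, hvS, hv⟩ := hS (2, ⟨i, hi⟩)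
      rcases FkGraph_adj_a hu with rfl | rfl | ⟨i', hi', rfl⟩ | ⟨h0, rfl⟩
      · have := hfS huS; simp at this; simp [this]
      · have := hfS huS; simp at this; simp [this]
      · rcases FkGraph_adj_c hv with rfl | rfl | ⟨i'', hi'', rfl⟩ | ⟨h0, rfl⟩
        · have := hfS hvS; simp at this; simp [this]
        · have := hfS hvS; simp at this; simp [this]
        · have h1 := hfS huS
          have h2 := hfS hvS
          simp only at hi' hi''
          rw [show (i'' : ℕ) = i' by omega] at h2
          subst hi'
          simp [h1, h2]
        · simp at hi' h0; omega
      · rcases FkGraph_adj_c hv with rfl | rfl | ⟨i'', hi'', rfl⟩ | ⟨h0', rfl⟩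
        · have := hfS hvS; simp at this; simp [this]
        · have := hfS hvS; simp at this; simp [this]
        · simp at hi'' h0; omega
        · simp at h0
          simp [h0, hgS huS, hgS hvS])
  have hAC := add_pred_le_sum k
    (x := fun i => if i = k then f 1 (k - 1) + f 3 (k - 1) else f 0 i + f 2 i) (by
      intro i hi
      have hne : i ≠ k := hi.ne
      obtain ⟨u, huS, hu⟩ := hS (1, ⟨i, hi⟩)
      obtain ⟨v, hvS, hv⟩ := hS (3, ⟨i, hi⟩)
      rcases FkGraph_adj_b hu with rfl | rfl | ⟨i', hi', rfl⟩ | ⟨h0, rfl⟩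
      · have := hfS huS; simp at this; simp [this, hne]
      · have := hfS huS; simp at this; simp [this, hne]
      · rcases FkGraph_adj_d hv with rfl | rfl | ⟨i'', hi'', rfl⟩ | ⟨h0, rfl⟩
        · have := hfS hvS; simp at this; simp [this, hne]
        · have := hfS hvS; simp at this; simp [this, hne]
        · have h1 := hfS huS
          have h2 := hfS hvS
          have := i'.2
          simp only at hi' hi''
          rw [hi'] at h1
          rw [hi''] at h2
          simp [h1, h2, show i + 1 ≠ k by omega]
        · have := i'.2
          simp only at hi' h0; omega
      · rcases FkGraph_adj_d hv with rfl | rfl | ⟨i'', hi'', rfl⟩ | ⟨h0', rfl⟩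
        · have := hfS hvS; simp at this; simp [this, hne]
        · have := hfS hvS; simp at this; simp [this, hne]
        · have := i''.2
          simp only at hi'' h0; omega
        · have h1 := hfS huS
          have h2 := hfS hvS
          simp only at h0 h1 h2
          subst h0
          simp [h1, h2])
  have hsum : ∑ i ∈ Finset.range k, (if i = k then f 1 (k - 1) + f 3 (k - 1) else f 0 i + f 2 i) =
      ∑ i ∈ Finset.range k, (f 0 i + f 2 i) :=
    Finset.sum_congr rfl fun i hi => if_neg (Finset.mem_range.1 hi).ne
  simp only [Nat.add_one_ne_zero, if_false, Nat.add_sub_cancel, if_true, hsum] at hBD hAC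
  have hgj : 1 ≤ g 0 + g 1 + g 2 := by
    have := hgS hj
    fin_cases j <;> simp at this <;> omega
  split_ifs at hBD hAC <;> omega

theorem almostTotalDominationNumber_le_card {V : Type*} [Fintype V] {G : SimpleGraph V} {v : V}
    {S : Finset V} (hv : v ∈ S) (hnv : ∀ u ∈ S, ¬ G.Adj v u)
    (hS : ∀ w : V, w ≠ v → ∃ u ∈ S, G.Adj w u) :
    almostTotalDominationNumber G v ≤ S.card :=
  Nat.sInf_le ⟨S, rfl, hv, hnv, hS⟩

/-- The vertices `v_j`, all `b_i`, and all `c_i` (if `j = 0`) or all `a_i` (otherwise). -/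
def FkDominatingSet (k : ℕ) (j : Fin 3) : Finset (FkVert k) :=
  (({1, if j = 0 then 2 else 0} : Finset (Fin 4)) ×ˢ Finset.univ).disjSum {j}

theorem card_FkDominatingSet (k : ℕ) (j : Fin 3) :
    (FkDominatingSet k j).card = 2 * k + 1 := by
  rw [FkDominatingSet, Finset.card_disjSum, Finset.card_product, Finset.card_pair]
  · simp
  · split_ifs <;> decide

theorem FkDominatingSet_not_adj {k : ℕ} {j : Fin 3} :
    ∀ u ∈ FkDominatingSet k j, ¬ (FkGraph k).Adj (Sum.inr j) u := by
  rintro (⟨t, i⟩ | t) hu <;> fin_cases j <;> fin_cases t <;>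
    simp [FkDominatingSet, FkGraph, fkRel] at hu ⊢

theorem FkDominatingSet_dominates {k : ℕ} (hk : 1 ≤ k) {j : Fin 3} (w : FkVert k)
    (hw : w ≠ Sum.inr j) : ∃ u ∈ FkDominatingSet k j, (FkGraph k).Adj w u := by
  rcases w with ⟨t, i⟩ | t
  · by_cases ht : t = 0 ∨ t = 2
    · refine ⟨Sum.inl (1, i), by simp [FkDominatingSet], ?_⟩
      rcases ht with rfl | rfl <;> simp [FkGraph, fkRel, gkBase]
    · refine ⟨Sum.inl (if j = 0 then 2 else 0, i), by simp [FkDominatingSet], ?_⟩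
      fin_cases t <;> fin_cases j <;> simp [FkGraph, fkRel, gkBase] at ht ⊢
  · by_cases h : j = 1 ∨ t = 1
    · refine ⟨Sum.inr j, by simp [FkDominatingSet], ?_⟩
      fin_cases t <;> fin_cases j <;> simp [FkGraph, fkRel] at h hw ⊢
    · refine ⟨Sum.inl (if j = 0 then 2 else 0, ⟨0, hk⟩), by simp [FkDominatingSet], ?_⟩
      fin_cases t <;> fin_cases j <;> simp [FkGraph, fkRel] at h hw ⊢

/-- For `k ≥ 1` and any vertex `w ∈ {v_1, v_2, v_3}` of the special 2-path
`a_1 v_1 v_2 v_3 c_1` of `F_k`, `γta(F_k; w) = (n − 1)/2 = 2k + 1`. -/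
theorem almostTotalDominationNumber_Fk (k : ℕ) (hk : 1 ≤ k) (j : Fin 3) :
    almostTotalDominationNumber (FkGraph k) (Sum.inr j) = 2 * k + 1 := by
  have hmem : Sum.inr j ∈ FkDominatingSet k j := by simp [FkDominatingSet]
  apply le_antisymm
  · rw [← card_FkDominatingSet k j]
    exact almostTotalDominationNumber_le_card hmem FkDominatingSet_not_adj
      (FkDominatingSet_dominates hk)
  · refine le_csInf ⟨_, _, rfl, hmem, FkDominatingSet_not_adj, FkDominatingSet_dominates hk⟩ ?_
    rintro n ⟨S, rfl, hj, -, hS⟩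
    exact two_mul_add_one_le_card_of_dominates S j hj fun p => hS _ (by simp)
end
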